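/- arXiv:2303.03479 — 2 statements merged into one kernel-verified Lean document; each statement's English description precedes it below -/
import Mathlib

section
/- Let ε > 1/4 be a real number, let G be a (2+ε)-tough graph on n ≥ 3 vertices, and let x and y be two non-adjacent vertices of G with d(x) + d(y) ≥ n − 2. Then G is Hamiltonian if and only if the graph G' obtained from G by adding the edge xy is Hamiltonian. -/
open SimpleGraph

/-- A graph `G` is `t`-tough if for every set `S` of vertices such that `G - S` is
disconnected, `t * c(G - S) ≤ |S|`, where `c` counts connected components. -/
def Tough {V : Type*} [Fintype V] (t : ℝ) (G : SimpleGraph V) : Prop :=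
  ∀ S : Finset V, ¬ (G.induce ((↑S : Set V)ᶜ)).Connected →
    t * (Nat.card (G.induce ((↑S : Set V)ᶜ)).ConnectedComponent) ≤ S.card

set_option linter.unusedSectionVars false

/-- routes along indices -/
def Rt {V : Type*} (G : SimpleGraph V) (p : ℕ → V) (i j m : ℕ) (Q : ℕ → Prop) : Prop :=
  ∃ w : G.Walk (p i) (p j), w.length = m ∧ ∀ k, Q k → p k ∈ w.support

structure Base {V : Type*} [Fintype V] [DecidableEq V] (G : SimpleGraph V) (p : ℕ → V) (n : ℕ) :
    Prop where
  hn : 3 ≤ n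
  card : Fintype.card V = n
  inj : ∀ i j, i < n → j < n → p i = p j → i = j
  surj : ∀ v, ∃ i, i < n ∧ p i = v
  adj : ∀ i, i + 1 < n → G.Adj (p i) (p (i + 1))
  nadj : ¬ G.Adj (p 0) (p (n - 1))
  nham : ¬ G.IsHamiltonian

section routes
variable {V : Type*} [Fintype V] [DecidableEq V] {G : SimpleGraph V} {p : ℕ → V} {n : ℕ}

theorem rt_up_aux (hadj : ∀ i, i + 1 < n → G.Adj (p i) (p (i + 1))) (i d : ℕ) (h : i + d < n) :
    Rt G p i (i + d) d (fun k => i ≤ k ∧ k ≤ i + d) := by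
  induction d with
  | zero =>
    refine ⟨SimpleGraph.Walk.nil, rfl, ?_⟩
    intro k hk
    have : k = i := by omega
    subst this
    simp
  | succ d ih =>
    obtain ⟨w, hw, hs⟩ := ih (by omega)
    refine ⟨w.concat (hadj (i + d) (by omega)), by simp [hw], ?_⟩
    intro k hk
    rw [SimpleGraph.Walk.support_concat, List.mem_append]
    by_cases hk' : k ≤ i + d
    · exact Or.inl (hs k ⟨hk.1, hk'⟩)
    · have : k = i + d + 1 := by omega
      subst this
      right; simp; rfl

theorem Rt.rev {i j m : ℕ} {Q : ℕ → Prop} (h : Rt G p i j m Q) : Rt G p j i m Q := by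
  obtain ⟨w, hw, hs⟩ := h
  exact ⟨w.reverse, by simp [hw], fun k hk => by simpa using hs k hk⟩

theorem Base.up (C : Base G p n) (i j : ℕ) (h : i ≤ j) (hj : j < n) :
    Rt G p i j (j - i) (fun k => i ≤ k ∧ k ≤ j) := by
  have := rt_up_aux C.adj i (j - i) (by omega)
  rwa [show i + (j - i) = j by omega] at this

theorem Base.down (C : Base G p n) (j i : ℕ) (h : i ≤ j) (hj : j < n) :
    Rt G p j i (j - i) (fun k => i ≤ k ∧ k ≤ j) := (C.up i j h hj).rev

theorem Rt.trans {i j k l m m' : ℕ} {Q Q' : ℕ → Prop} (h : Rt G p i j m Q)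
    (hjk : G.Adj (p j) (p k)) (h' : Rt G p k l m' Q') :
    Rt G p i l (m + m' + 1) (fun x => Q x ∨ Q' x) := by
  obtain ⟨w, hw, hs⟩ := h
  obtain ⟨w', hw', hs'⟩ := h'
  refine ⟨w.append (SimpleGraph.Walk.cons hjk w'), by simp [hw, hw']; omega, ?_⟩
  intro x hx
  rw [SimpleGraph.Walk.mem_support_append_iff]
  rcases hx with hx | hx
  · exact Or.inl (hs x hx)
  · right; simp [hs' x hx]

theorem Base.ham (C : Base G p n) {i j m : ℕ} {Q : ℕ → Prop} (h : Rt G p i j m Q)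
    (hji : G.Adj (p j) (p i)) (hm : m + 1 = n) (hQ : ∀ k, k < n → Q k) : False := by
  apply C.nham
  intro _
  obtain ⟨w, hw, hs⟩ := h
  have hall : ∀ v, v ∈ w.support := by
    intro v
    obtain ⟨k, hk, rfl⟩ := C.surj v
    exact hs k (hQ k hk)
  have hpath : w.IsPath := by
    rw [SimpleGraph.Walk.isPath_def]
    rw [← Multiset.coe_nodup, ← Multiset.toFinset_card_eq_card_iff_nodup]
    have : (w.support : Multiset V).toFinset = Finset.univ := by
      ext v; simp [hall v]
    rw [this, Finset.card_univ, C.card]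
    simp [hw, hm]
  refine ⟨p j, SimpleGraph.Walk.cons hji w, ?_⟩
  rw [SimpleGraph.Walk.isHamiltonianCycle_iff_isCycle_and_length_eq,
    SimpleGraph.Walk.isCycle_iff_isPath_tail_and_le_length]
  have := C.hn
  have := C.card
  refine ⟨⟨by simpa using hpath, ?_⟩, ?_⟩ <;> simp <;> omega

theorem Base.h0 (C : Base G p n) (i : ℕ) (hi : i + 1 < n) (h1 : G.Adj (p 0) (p (i + 1)))
    (h2 : G.Adj (p (n - 1)) (p i)) : False :=
  C.ham ((C.up 0 i (by omega) (by omega)).trans h2.symm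
    (C.down (n - 1) (i + 1) (by omega) (by omega))) h1.symm (by omega) (by intro k hk; omega)

theorem Base.h1 (C : Base G p n) (i j : ℕ) (hi : i + 2 ≤ j) (hj : j < n) (h : G.Adj (p i) (p j))
    (h1 : G.Adj (p 0) (p (i + 1))) (h2 : G.Adj (p (n - 1)) (p (j - 1))) : False :=
  C.ham (((C.up 0 i (by omega) (by omega)).trans h
    (C.up j (n - 1) (by omega) (by omega))).trans h2
    (C.down (j - 1) (i + 1) (by omega) (by omega)))
    h1.symm (by omega) (by intro k hk; omega)

theorem Base.h2 (C : Base G p n) (i j : ℕ) (hi : i + 2 ≤ j) (hj : j < n) (h : G.Adj (p i) (p j))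
    (h1 : G.Adj (p (n - 1)) (p (i + 1))) (h2 : G.Adj (p 0) (p (j - 1))) : False :=
  C.ham (((C.up 0 i (by omega) (by omega)).trans h
    (C.up j (n - 1) (by omega) (by omega))).trans h1
    (C.up (i + 1) (j - 1) (by omega) (by omega)))
    h2.symm (by omega) (by intro k hk; omega)

theorem Base.h3 (C : Base G p n) (i j : ℕ) (h0 : 1 ≤ i) (hi : i + 1 ≤ j) (hj : j < n)
    (h : G.Adj (p i) (p j))
    (h1 : G.Adj (p (n - 1)) (p (i - 1))) (h2 : G.Adj (p 0) (p (j - 1))) : False :=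
  C.ham (((C.down (n - 1) j (by omega) (by omega)).trans h.symm
    (C.up i (j - 1) (by omega) (by omega))).trans h2.symm
    (C.up 0 (i - 1) (by omega) (by omega)))
    h1.symm (by omega) (by intro k hk; omega)

theorem Base.h4 (C : Base G p n) (i j : ℕ) (hi : i + 1 ≤ j) (hj : j + 1 < n)
    (h : G.Adj (p i) (p j))
    (h1 : G.Adj (p (n - 1)) (p (i + 1))) (h2 : G.Adj (p 0) (p (j + 1))) : False :=
  C.ham (((C.up 0 i (by omega) (by omega)).trans h
    (C.down j (i + 1) (by omega) (by omega))).trans h1.symm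
    (C.down (n - 1) (j + 1) (by omega) (by omega)))
    h2.symm (by omega) (by intro k hk; omega)

/-- case II, neighbour before `i` -/
theorem Base.k1 (C : Base G p n) (i r u : ℕ) (hi : i + 2 ≤ r) (hr : r + 2 < n)
    (hw : G.Adj (p i) (p (r + 1)))
    (hx : G.Adj (p 0) (p (i + 1))) (hu : 1 ≤ u) (hui : u ≤ i)
    (h : G.Adj (p r) (p u)) (hy : G.Adj (p (n - 1)) (p (u - 1))) : False :=
  C.ham ((((C.down r (i + 1) (by omega) (by omega)).trans hx.symm
    (C.up 0 (u - 1) (by omega) (by omega))).trans hy.symm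
    (C.down (n - 1) (r + 1) (by omega) (by omega))).trans hw.symm
    (C.down i u (by omega) (by omega)))
    h.symm (by omega) (by intro k hk; omega)

theorem Base.k2 (C : Base G p n) (i r u : ℕ) (hr : r + 2 < n)
    (hw : G.Adj (p i) (p (r + 1)))
    (hx : G.Adj (p 0) (p (i + 1))) (hu : i + 1 ≤ u) (hui : u + 2 ≤ r)
    (h : G.Adj (p r) (p u)) (hy : G.Adj (p (n - 1)) (p (u + 1))) : False :=
  C.ham ((((C.down r (u + 1) (by omega) (by omega)).trans hy.symm
    (C.down (n - 1) (r + 1) (by omega) (by omega))).trans hw.symm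
    (C.down i 0 (by omega) (by omega))).trans hx
    (C.up (i + 1) u (by omega) (by omega)))
    h.symm (by omega) (by intro k hk; omega)

theorem Base.k3 (C : Base G p n) (i r u : ℕ) (hi : i + 2 ≤ r)
    (hw : G.Adj (p i) (p (r + 1)))
    (hx : G.Adj (p 0) (p (i + 1))) (hu : r + 3 ≤ u) (hui : u < n)
    (h : G.Adj (p r) (p u)) (hy : G.Adj (p (n - 1)) (p (u - 1))) : False :=
  C.ham ((((C.down r (i + 1) (by omega) (by omega)).trans hx.symm
    (C.up 0 i (by omega) (by omega))).trans hw
    (C.up (r + 1) (u - 1) (by omega) (by omega))).trans hy.symm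
    (C.down (n - 1) u (by omega) (by omega)))
    h.symm (by omega) (by intro k hk; omega)

theorem Base.tough_f (C : Base G p n) {t : ℝ} (ht : 9 / 4 < t) (hT : Tough t G)
    (S : Finset ℕ) (f : ℕ → ℕ)
    (hf : ∀ i j, i < n → j < n → i ∉ S → j ∉ S → G.Adj (p i) (p j) → f i = f j)
    (K : Finset ℕ) (hK : ∀ k ∈ K, ∃ i, i < n ∧ i ∉ S ∧ f i = k) (h2 : 2 ≤ K.card) :
    9 * K.card < 4 * S.card := by
  classical
  choose idx hidx hpidx using C.surj
  have hidp : ∀ i, i < n → idx (p i) = i := fun i hi =>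
    C.inj _ _ (hidx _) hi (hpidx _)
  set S' : Finset V := (S.filter (· < n)).image p with hS'
  have hmem : ∀ v, v ∉ S' → idx v ∉ S := by
    intro v hv hmem
    apply hv
    rw [hS', Finset.mem_image]
    exact ⟨idx v, by simp [hmem, hidx v], hpidx v⟩
  have hmem' : ∀ i, i < n → i ∉ S → p i ∉ S' := by
    intro i hi hiS hmem
    rw [hS', Finset.mem_image] at hmem
    obtain ⟨j, hj, hji⟩ := hmem
    rw [Finset.mem_filter] at hj
    have := C.inj _ _ hj.2 hi hji
    exact hiS (this ▸ hj.1)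
  set H := G.induce ((↑S' : Set V)ᶜ) with hH
  have hwalk : ∀ u v : ((↑S' : Set V)ᶜ : Set V), ∀ w : H.Walk u v, f (idx u) = f (idx v) := by
    intro u v w
    induction w with
    | nil => rfl
    | cons h w ih =>
      rw [← ih]
      rename_i a b c
      apply hf _ _ (hidx _) (hidx _) (hmem _ (fun h => a.2 (Finset.mem_coe.2 h))) (hmem _ (fun h => b.2 (Finset.mem_coe.2 h)))
      rw [hpidx, hpidx]
      simpa [hH] using h
  let F : H.ConnectedComponent → ℕ :=
    SimpleGraph.ConnectedComponent.lift (fun v => f (idx v)) (fun u v w _ => hwalk u v w)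
  have hF : ∀ i (hi : i < n) (hiS : i ∉ S),
      F (H.connectedComponentMk ⟨p i, by simpa using hmem' i hi hiS⟩) = f i := by
    intro i hi hiS
    simp [F, hidp i hi]
  have hsub : K ⊆ Finset.univ.image F := by
    intro k hk
    obtain ⟨i, hi, hiS, rfl⟩ := hK k hk
    rw [Finset.mem_image]
    exact ⟨_, Finset.mem_univ _, hF i hi hiS⟩
  have hcard : K.card ≤ Nat.card H.ConnectedComponent := by
    rw [Nat.card_eq_fintype_card]
    exact (Finset.card_le_card hsub).trans Finset.card_image_le
  have hnc : ¬ H.Connected := by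
    intro hc
    obtain ⟨k, hk, l, hl, hkl⟩ := Finset.one_lt_card.1 h2
    obtain ⟨i, hi, hiS, rfl⟩ := hK k hk
    obtain ⟨j, hj, hjS, rfl⟩ := hK l hl
    apply hkl
    rw [← hF i hi hiS, ← hF j hj hjS]
    congr 1
    rw [SimpleGraph.ConnectedComponent.eq]
    exact hc.preconnected _ _
  have := hT S' hnc
  have h3 : S'.card ≤ S.card := Finset.card_image_le.trans (Finset.card_filter_le _ _)
  have h4 : (K.card : ℝ) ≤ Nat.card H.ConnectedComponent := by exact_mod_cast hcard
  have h5 : (S'.card : ℝ) ≤ S.card := by exact_mod_cast h3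
  have h6 : (2 : ℝ) ≤ K.card := by exact_mod_cast h2
  have h7 : (9 : ℝ) * K.card < 4 * S.card := by nlinarith
  exact_mod_cast h7

theorem Base.tough_T (C : Base G p n) {t : ℝ} (ht : 9 / 4 < t) (hT : Tough t G)
    (S T : Finset ℕ) (hTn : ∀ i ∈ T, i < n) (hST : ∀ i ∈ T, i ∉ S) (h0S : 0 ∉ S) (h0T : 0 ∉ T)
    (hN : ∀ i ∈ T, ∀ j, j < n → G.Adj (p i) (p j) → j ∈ S) (hne : T.Nonempty) :
    9 * (T.card + 1) < 4 * S.card := by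
  have hn := C.hn
  have := C.tough_f ht hT S (fun i => if i ∈ T then i else 0) ?_ (insert 0 T) ?_ ?_
  · rwa [Finset.card_insert_of_notMem h0T] at this
  · intro i j hi hj hiS hjS hadj
    have h1 : i ∉ T := fun h => hjS (hN i h j hj hadj)
    have h2 : j ∉ T := fun h => hiS (hN j h i hi hadj.symm)
    simp [h1, h2]
  · intro k hk
    rw [Finset.mem_insert] at hk
    rcases hk with rfl | hk
    · exact ⟨0, by omega, h0S, by simp⟩
    · exact ⟨k, hTn k hk, hST k hk, by simp [hk]⟩
  · rw [Finset.card_insert_of_notMem h0T]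
    have := hne.card_pos
    omega
end routes

/-- `p i` is a neighbour of `x = p 0` -/
def NA {V : Type*} (G : SimpleGraph V) (p : ℕ → V) (n i : ℕ) : Prop :=
  i < n ∧ G.Adj (p 0) (p i)
/-- `p i` is a neighbour of `y = p (n-1)` -/
def NB {V : Type*} (G : SimpleGraph V) (p : ℕ → V) (n i : ℕ) : Prop :=
  i < n ∧ G.Adj (p (n - 1)) (p i)

structure Cfg {V : Type*} [Fintype V] [DecidableEq V] (G : SimpleGraph V) (p : ℕ → V) (n q : ℕ) :
    Prop extends Base G p n where
  lab : ∀ i, i + 1 < n → i ≠ q → NA G p n (i + 1) ∨ NB G p n i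
  labq : q + 1 < n → ¬ NA G p n (q + 1) ∧ ¬ NB G p n q

open Classical in
/-- vertices adjacent to neither end -/
noncomputable def WW {V : Type*} (G : SimpleGraph V) (p : ℕ → V) (n : ℕ) : Finset ℕ :=
  (Finset.range n).filter (fun i => 0 < i ∧ i + 1 < n ∧ ¬ NA G p n i ∧ ¬ NB G p n i)

open Classical in
/-- common neighbours -/
noncomputable def CC {V : Type*} (G : SimpleGraph V) (p : ℕ → V) (n : ℕ) : Finset ℕ :=
  (Finset.range n).filter (fun i => NA G p n i ∧ NB G p n i)

/-- good vertices -/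
noncomputable def WG {V : Type*} (G : SimpleGraph V) (p : ℕ → V) (n q : ℕ) : Finset ℕ :=
  WW G p n \ {q, q + 1}

section labels
variable {V : Type*} [Fintype V] [DecidableEq V] {G : SimpleGraph V} {p : ℕ → V} {n q : ℕ}

theorem mem_WW {i : ℕ} : i ∈ WW G p n ↔ 0 < i ∧ i + 1 < n ∧ ¬ NA G p n i ∧ ¬ NB G p n i := by
  simp only [WW, Finset.mem_filter, Finset.mem_range]
  constructor
  · exact fun h => h.2
  · exact fun h => ⟨by omega, h⟩

theorem mem_CC {i : ℕ} : i ∈ CC G p n ↔ NA G p n i ∧ NB G p n i := by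
  simp only [CC, Finset.mem_filter, Finset.mem_range]
  constructor
  · exact fun h => h.2
  · exact fun h => ⟨h.1.1, h⟩

theorem mem_WG {i : ℕ} : i ∈ WG G p n q ↔ i ∈ WW G p n ∧ i ≠ q ∧ i ≠ q + 1 := by
  simp [WG]

theorem Base.a_pos (C : Base G p n) {i : ℕ} (h : NA G p n i) : 0 < i ∧ i + 1 < n := by
  obtain ⟨h1, h2⟩ := h
  have h3 : i ≠ 0 := by rintro rfl; exact G.irrefl h2
  have h4 : i ≠ n - 1 := by rintro rfl; exact C.nadj h2
  omega

theorem Base.b_pos (C : Base G p n) {i : ℕ} (h : NB G p n i) : 0 < i ∧ i + 1 < n := by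
  obtain ⟨h1, h2⟩ := h
  have h3 : i ≠ 0 := by rintro rfl; exact C.nadj h2.symm
  have h4 : i ≠ n - 1 := by rintro rfl; exact G.irrefl h2
  omega

theorem Base.a_one (C : Base G p n) : NA G p n 1 :=
  ⟨by have := C.hn; omega, C.adj 0 (by have := C.hn; omega)⟩

theorem Base.b_last (C : Base G p n) : NB G p n (n - 2) := by
  have := C.hn
  refine ⟨by omega, ?_⟩
  have h := C.adj (n - 2) (by omega)
  rw [show n - 2 + 1 = n - 1 by omega] at h
  exact h.symm

theorem Base.excl (C : Base G p n) {i : ℕ} (h1 : NA G p n (i + 1)) (h2 : NB G p n i) : False :=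
  C.h0 i h1.1 h1.2 h2.2

theorem Cfg.exC (C : Cfg G p n q) {s e : ℕ} (hse : s < e) (h1 : NA G p n (s + 1))
    (h2 : NB G p n e) (hq : ∀ i, s ≤ i → i ≤ e → i ≠ q) :
    ∃ c, s < c ∧ c ≤ e ∧ c ∈ CC G p n := by
  classical
  have hex : ∃ i, s < i ∧ NB G p n i := ⟨e, hse, h2⟩
  have hm : ∀ m, m < Nat.find hex → ¬ (s < m ∧ NB G p n m) := fun m h => Nat.find_min hex h
  obtain ⟨g1, g2⟩ := Nat.find_spec hex
  have g3 : Nat.find hex ≤ e := Nat.find_min' hex ⟨hse, h2⟩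
  set i := Nat.find hex
  refine ⟨i, g1, g3, mem_CC.2 ⟨?_, g2⟩⟩
  have := C.lab (i - 1) (by have := C.b_pos g2; omega) (hq _ (by omega) (by omega))
  rw [show i - 1 + 1 = i by omega] at this
  rcases this with h | h
  · exact h
  · by_cases hs : i - 1 = s
    · rw [hs] at h
      exact (C.excl h1 h).elim
    · exact (hm (i - 1) (by omega) ⟨by omega, h⟩).elim

theorem Base.exW (C : Base G p n) {s e : ℕ} (hse : s < e) (h1 : NB G p n s)
    (h2 : NA G p n (e + 1)) :
    ∃ c, s < c ∧ c ≤ e ∧ c ∈ WW G p n := by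
  classical
  have hex : ∃ i, s < i ∧ NA G p n (i + 1) := ⟨e, hse, h2⟩
  have hm : ∀ m, m < Nat.find hex → ¬ (s < m ∧ NA G p n (m + 1)) :=
    fun m h => Nat.find_min hex h
  obtain ⟨g1, g2⟩ := Nat.find_spec hex
  have g3 : Nat.find hex ≤ e := Nat.find_min' hex ⟨hse, h2⟩
  set i := Nat.find hex
  refine ⟨i, g1, g3, mem_WW.2 ⟨by omega, g2.1, ?_, fun h => C.excl g2 h⟩⟩
  intro h
  rw [show i = i - 1 + 1 by omega] at h
  by_cases hs : i - 1 = s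
  · rw [hs] at h
    exact (C.excl h h1).elim
  · exact (hm (i - 1) (by omega) ⟨by omega, h⟩).elim

/-- counting -/
theorem Cfg.cards (C : Cfg G p n q) :
    (CC G p n).card ≤ (WW G p n).card + 1 ∧
      (q + 1 < n → (CC G p n).card ≤ (WW G p n).card) := by
  classical
  have hn := C.hn
  set A := (Finset.range n).filter (fun i => NA G p n i) with hA
  set B := (Finset.range n).filter (fun i => NB G p n i) with hB
  have mA : ∀ i, i ∈ A ↔ NA G p n i := by
    intro i; simp only [hA, Finset.mem_filter, Finset.mem_range]
    exact ⟨fun h => h.2, fun h => ⟨h.1, h⟩⟩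
  have mB : ∀ i, i ∈ B ↔ NB G p n i := by
    intro i; simp only [hB, Finset.mem_filter, Finset.mem_range]
    exact ⟨fun h => h.2, fun h => ⟨h.1, h⟩⟩
  have e1 : CC G p n = A ∩ B := by
    ext i; rw [mem_CC, Finset.mem_inter, mA, mB]
  have e2 : (A ∪ B).card + (WW G p n).card = n - 2 := by
    rw [← Finset.card_union_of_disjoint]
    · have : (A ∪ B) ∪ WW G p n = Finset.Ico 1 (n - 1) := by
        ext i
        simp only [Finset.mem_union, mA, mB, mem_WW, Finset.mem_Ico]
        constructor
        · rintro ((h | h) | h)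
          · have := C.a_pos h; omega
          · have := C.b_pos h; omega
          · omega
        · intro h
          by_cases h1 : NA G p n i
          · tauto
          by_cases h2 : NB G p n i
          · tauto
          · exact Or.inr ⟨by omega, by omega, h1, h2⟩
      rw [this, Nat.card_Ico]; omega
    · rw [Finset.disjoint_left]
      intro i hi hi'
      rw [mem_WW] at hi'
      simp only [Finset.mem_union, mA, mB] at hi
      tauto
  have e3 := Finset.card_union_add_card_inter A B
  have e4 : (A.image (· - 1)).card = A.card := by
    apply Finset.card_image_of_injOn
    intro i hi j hj hij
    have h1 := C.a_pos ((mA i).1 hi)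
    have h2 := C.a_pos ((mA j).1 hj)
    simp only at hij
    omega
  have mA' : ∀ i, i ∈ A.image (· - 1) → NA G p n (i + 1) := by
    intro i hi
    rw [Finset.mem_image] at hi
    obtain ⟨j, hj, rfl⟩ := hi
    have := C.a_pos ((mA j).1 hj)
    rw [show j - 1 + 1 = j by omega]
    exact (mA j).1 hj
  have e5 : (A.image (· - 1) ∪ B).card = A.card + B.card := by
    rw [Finset.card_union_of_disjoint, e4]
    rw [Finset.disjoint_left]
    intro i hi hi'
    exact C.excl (mA' i hi) ((mB i).1 hi')
  have e6 : A.image (· - 1) ∪ B ⊆ Finset.range (n - 1) := by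
    intro i hi
    rw [Finset.mem_union] at hi
    rw [Finset.mem_range]
    rcases hi with hi | hi
    · have := C.a_pos (mA' i hi); omega
    · have := C.b_pos ((mB i).1 hi); omega
  rw [e1]
  constructor
  · have := Finset.card_le_card e6
    rw [Finset.card_range] at this
    omega
  · intro hq
    have hq' := C.labq hq
    have : A.image (· - 1) ∪ B ⊆ (Finset.range (n - 1)).erase q := by
      intro i hi
      rw [Finset.mem_erase]
      refine ⟨?_, e6 hi⟩
      rintro rfl
      rw [Finset.mem_union] at hi
      rcases hi with hi | hi
      · exact hq'.1 (mA' _ hi)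
      · exact hq'.2 ((mB _).1 hi)
    have := Finset.card_le_card this
    rw [Finset.card_erase_of_mem (Finset.mem_range.2 (by omega)), Finset.card_range] at this
    omega

theorem Cfg.wnext (C : Cfg G p n q) {i : ℕ} (hi : i ∈ WW G p n) (h : i ≠ q) :
    NA G p n (i + 1) := by
  rw [mem_WW] at hi
  exact (C.lab i hi.2.1 h).resolve_right hi.2.2.2

theorem Cfg.wprev (C : Cfg G p n q) {i : ℕ} (hi : i ∈ WW G p n) (h : i ≠ q + 1) :
    NB G p n (i - 1) := by
  rw [mem_WW] at hi
  have := C.lab (i - 1) (by omega) (by omega)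
  rw [show i - 1 + 1 = i by omega] at this
  exact this.resolve_left hi.2.2.1

theorem Cfg.fwd (C : Cfg G p n q) {i j : ℕ} (hi : i ∈ WG G p n q) (hij : i < j) (hj : j < n)
    (h : G.Adj (p i) (p j)) : j - 1 ∈ WW G p n := by
  rw [mem_WG] at hi
  obtain ⟨h1, h2, h3⟩ := hi
  by_cases hj' : j = i + 1
  · subst hj'; simpa using h1
  have ha := C.wnext h1 h2
  have hb := C.wprev h1 h3
  rw [mem_WW] at h1
  refine mem_WW.2 ⟨by omega, by omega, fun g => ?_, fun g => ?_⟩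
  · exact C.h3 i j (by omega) (by omega) hj h hb.2 g.2
  · exact C.h1 i j (by omega) hj h ha.2 g.2

theorem Cfg.bwd (C : Cfg G p n q) {i j : ℕ} (hi : i ∈ WG G p n q) (hij : j < i)
    (h : G.Adj (p i) (p j)) : j + 1 ∈ WW G p n := by
  rw [mem_WG] at hi
  obtain ⟨h1, h2, h3⟩ := hi
  by_cases hj' : j + 1 = i
  · rw [hj']; exact h1
  have ha := C.wnext h1 h2
  have hb := C.wprev h1 h3
  rw [mem_WW] at h1
  refine mem_WW.2 ⟨by omega, by omega, fun g => ?_, fun g => ?_⟩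
  · exact C.h1 j i (by omega) (by omega) h.symm g.2 hb.2
  · exact C.h4 j i (by omega) (by omega) h.symm g.2 ha.2

/-- neighbours of good vertices along the path -/
noncomputable def PM {V : Type*} (G : SimpleGraph V) (p : ℕ → V) (n q : ℕ) : Finset ℕ :=
  (WG G p n q).image (· + 1) ∪ (WG G p n q).image (· - 1)

theorem PM_card : (PM G p n q).card ≤ 2 * (WG G p n q).card := by
  have := Finset.card_union_le ((WG G p n q).image (· + 1)) ((WG G p n q).image (· - 1))
  have h1 := Finset.card_image_le (s := WG G p n q) (f := (· + 1))
  have h2 := Finset.card_image_le (s := WG G p n q) (f := (· - 1))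
  unfold PM
  omega

theorem mem_PM_s {i : ℕ} (h : i ∈ WG G p n q) : i + 1 ∈ PM G p n q :=
  Finset.mem_union_left _ (Finset.mem_image_of_mem _ h)

theorem mem_PM_p {i : ℕ} (h : i ∈ WG G p n q) : i - 1 ∈ PM G p n q :=
  Finset.mem_union_right _ (Finset.mem_image_of_mem (· - 1) h)

theorem Cfg.PM_ab (C : Cfg G p n q) {i : ℕ} (h : i ∈ PM G p n q) :
    NA G p n i ∨ NB G p n i := by
  rw [PM, Finset.mem_union, Finset.mem_image, Finset.mem_image] at h
  rcases h with ⟨j, hj, rfl⟩ | ⟨j, hj, rfl⟩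
  · rw [mem_WG] at hj
    exact Or.inl (C.wnext hj.1 hj.2.1)
  · rw [mem_WG] at hj
    exact Or.inr (C.wprev hj.1 hj.2.2)

theorem Cfg.PM_W (C : Cfg G p n q) {i : ℕ} (h : i ∈ PM G p n q) : i ∉ WW G p n := by
  intro hi
  rw [mem_WW] at hi
  have := C.PM_ab h
  tauto

theorem Cfg.PM_0 (C : Cfg G p n q) : 0 ∉ PM G p n q := by
  intro h
  rcases C.PM_ab h with h | h
  · exact absurd (C.a_pos h).1 (by omega)
  · exact absurd (C.b_pos h).1 (by omega)

theorem Cfg.nb (C : Cfg G p n q) {i j : ℕ} (hi : i ∈ WG G p n q) (hj : j < n)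
    (h : G.Adj (p i) (p j)) : j ∈ PM G p n q ∨
      (i < j ∧ (j = q + 1 ∧ q ∈ WW G p n ∨ j = q + 2 ∧ q + 1 ∈ WW G p n)) ∨
      (j < i ∧ (j + 1 = q ∧ q ∈ WW G p n ∨ j = q ∧ q + 1 ∈ WW G p n)) := by
  have hne : i ≠ j := by rintro rfl; exact G.irrefl h
  rcases Nat.lt_or_gt_of_ne hne with hlt | hlt
  · have hw := C.fwd hi hlt hj h
    by_cases h1 : j - 1 = q
    · right; left; refine ⟨hlt, Or.inl ⟨by omega, h1 ▸ hw⟩⟩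
    by_cases h2 : j - 1 = q + 1
    · right; left; refine ⟨hlt, Or.inr ⟨by omega, h2 ▸ hw⟩⟩
    left
    have := mem_PM_s (mem_WG.2 ⟨hw, h1, h2⟩)
    rwa [show j - 1 + 1 = j by omega] at this
  · have hw := C.bwd hi hlt h
    by_cases h1 : j + 1 = q
    · right; right; refine ⟨hlt, Or.inl ⟨by omega, h1 ▸ hw⟩⟩
    by_cases h2 : j + 1 = q + 1
    · right; right; refine ⟨hlt, Or.inr ⟨by omega, h2 ▸ hw⟩⟩
    left
    have := mem_PM_p (mem_WG.2 ⟨hw, h1, h2⟩)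
    rwa [show j + 1 - 1 = j by omega] at this

theorem Cfg.WG_lt (_C : Cfg G p n q) : ∀ i ∈ WG G p n q, i < n := by
  intro i hi
  rw [mem_WG, mem_WW] at hi
  omega

theorem Cfg.caseR (C : Cfg G p n q) {t : ℝ} (ht : 9 / 4 < t) (hT : Tough t G)
    (hne : (WG G p n q).Nonempty) (R : Finset ℕ) (hR : R.card ≤ 2) (h0 : 0 ∉ R)
    (hRW : ∀ i ∈ R, i ∉ WG G p n q)
    (hN : ∀ i ∈ WG G p n q, ∀ j, j < n → G.Adj (p i) (p j) → j ∈ PM G p n q ∨ j ∈ R) : False := by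
  have := C.tough_T ht hT (PM G p n q ∪ R) (WG G p n q) C.WG_lt ?_ ?_ ?_ ?_ hne
  · have h1 := Finset.card_union_le (PM G p n q) R
    have h2 := PM_card (G := G) (p := p) (n := n) (q := q)
    omega
  · intro i hi hi'
    rw [Finset.mem_union] at hi'
    rcases hi' with hi' | hi'
    · exact C.PM_W hi' (mem_WG.1 hi).1
    · exact hRW i hi' hi
  · rw [Finset.mem_union]
    rintro (h | h)
    · exact C.PM_0 h
    · exact h0 h
  · intro h
    have := mem_WW.1 (mem_WG.1 h).1
    omega
  · intro i hi j hj h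
    rw [Finset.mem_union]
    exact hN i hi j hj h

end labels

section caseTwo
variable {V : Type*} [Fintype V] [DecidableEq V] {G : SimpleGraph V} {p : ℕ → V} {n q : ℕ}

theorem Cfg.caseII (C : Cfg G p n q) {t : ℝ} (ht : 9 / 4 < t) (hT : Tough t G)
    (hq : q ∈ WW G p n) (hq1 : q + 1 ∈ WW G p n) {w : ℕ} (hw : w ∈ WG G p n q) (hwq : w < q)
    (hadj : G.Adj (p w) (p (q + 1))) : False := by
  have bq : NB G p n (q - 1) := C.wprev hq (by omega)
  have aq : NA G p n (q + 2) := C.wnext hq1 (by omega)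
  have hw' := mem_WG.1 hw
  have aw : NA G p n (w + 1) := C.wnext hw'.1 hw'.2.1
  have hwne : w ≠ q - 1 := by
    rintro rfl
    exact (mem_WW.1 hw'.1).2.2.2 bq
  have hwq2 : w + 2 ≤ q := by omega
  have hqn : q + 2 < n := aq.1
  have hqW := mem_WW.1 hq
  have hq1W := mem_WW.1 hq1
  have k3 : ∀ j, q + 3 ≤ j → j < n → G.Adj (p q) (p j) → ¬ NB G p n (j - 1) :=
    fun j h1 h2 h3 h4 => C.k3 w q j hwq2 hadj aw.2 h1 h2 h3 h4.2
  set S1 : Finset ℕ := PM G p n q ∪ {q - 1, q + 1, q + 2} with hS1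
  have mS1 : ∀ j, j ∈ S1 ↔ j ∈ PM G p n q ∨ j = q - 1 ∨ j = q + 1 ∨ j = q + 2 := by
    intro j; simp [hS1]; tauto
  have nbS1 : ∀ i ∈ WG G p n q, ∀ j, j < n → G.Adj (p i) (p j) → j ∈ S1 := by
    intro i hi j hj h
    rw [mS1]
    rcases C.nb hi hj h with h1 | ⟨h1, h2 | h2⟩ | ⟨h1, h2 | ⟨rfl, h2⟩⟩
    · exact Or.inl h1
    · omega
    · omega
    · omega
    · exfalso
      have hi' := mem_WG.1 hi
      have : i ≠ j + 2 := by
        rintro rfl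
        exact (mem_WW.1 hi'.1).2.2.1 aq
      have hin := C.WG_lt i hi
      exact k3 i (by omega) hin h.symm (C.wprev hi'.1 hi'.2.2)
  have WGS1 : ∀ i ∈ WG G p n q, i ∉ S1 := by
    intro i hi h
    have hi' := mem_WG.1 hi
    have hiW := mem_WW.1 hi'.1
    rw [mS1] at h
    rcases h with h | rfl | h | rfl
    · exact C.PM_W h hi'.1
    · exact hiW.2.2.2 bq
    · exact hi'.2.2 h
    · exact hiW.2.2.1 aq
  have h0S1 : 0 ∉ S1 := by
    rw [mS1]
    rintro (h | h | h | h)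
    · exact C.PM_0 h
    · have := C.b_pos bq; omega
    · omega
    · omega
  have h0WG : 0 ∉ WG G p n q := by
    intro h
    have := mem_WW.1 (mem_WG.1 h).1
    omega
  have cS1 : S1.card ≤ 2 * (WG G p n q).card + 3 := by
    have h1 : S1.card ≤ (PM G p n q).card + ({q - 1, q + 1, q + 2} : Finset ℕ).card :=
      Finset.card_union_le _ _
    have h2 := PM_card (G := G) (p := p) (n := n) (q := q)
    have h3 := Finset.card_le_three (a := q - 1) (b := q + 1) (c := q + 2)
    omega
  have r1 := C.tough_T ht hT S1 (WG G p n q) C.WG_lt WGS1 h0S1 h0WG nbS1 ⟨w, hw⟩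
  have cWW : (WW G p n).card = (WG G p n q).card + 2 := by
    have h1 : ({q, q + 1} : Finset ℕ) ⊆ WW G p n := by
      intro i hi
      simp only [Finset.mem_insert, Finset.mem_singleton] at hi
      rcases hi with rfl | rfl
      · exact hq
      · exact hq1
    have h2 := Finset.card_sdiff_add_card_eq_card h1
    rw [Finset.card_pair (by omega)] at h2
    rw [WG]; exact h2.symm
  have hcards := C.cards.2 (by omega)
  obtain ⟨c1, hc1, hc1', hc1C⟩ := C.exC (s := w) (e := q - 1) (by omega) aw bq
    (by intro i _ _; omega)
  obtain ⟨c2, hc2, hc2', hc2C⟩ := C.exC (s := q + 1) (e := n - 2)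
    (by have := C.a_pos aq; omega) aq C.b_last (by intro i _ _; omega)
  set D := (CC G p n).filter (· < w) with hD
  have cD : D.card + 2 ≤ (CC G p n).card := by
    have h1 : D ∪ {c1, c2} ⊆ CC G p n := by
      intro i hi
      simp only [Finset.mem_union, hD, Finset.mem_filter, Finset.mem_insert,
        Finset.mem_singleton] at hi
      rcases hi with hi | rfl | rfl
      · exact hi.1
      · exact hc1C
      · exact hc2C
    have h2 := Finset.card_le_card h1
    rwa [Finset.card_union_of_disjoint, Finset.card_pair (by omega)] at h2
    rw [Finset.disjoint_left]
    intro i hi hi'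
    simp only [hD, Finset.mem_filter, Finset.mem_insert, Finset.mem_singleton] at hi hi'
    omega
  have hqWG : q ∉ WG G p n q := fun h => (mem_WG.1 h).2.1 rfl
  have DW : ∀ i ∈ D, i ∉ WW G p n := by
    intro i hi h
    rw [hD, Finset.mem_filter, mem_CC] at hi
    exact (mem_WW.1 h).2.2.1 hi.1.1
  have r2 := C.tough_T ht hT (S1 ∪ D) (insert q (WG G p n q)) ?_ ?_ ?_ ?_ ?_ ⟨q, by simp⟩
  · rw [Finset.card_insert_of_notMem hqWG] at r2
    have h1 := Finset.card_union_le S1 D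
    omega
  · intro i hi
    rcases Finset.mem_insert.1 hi with rfl | hi
    · omega
    · exact C.WG_lt i hi
  · intro i hi h
    rw [Finset.mem_union] at h
    rcases Finset.mem_insert.1 hi with rfl | hi
    · rcases h with h | h
      · rw [mS1] at h
        rcases h with h | h | h | h
        · exact C.PM_W h hq
        · omega
        · omega
        · omega
      · exact DW _ h hq
    · rcases h with h | h
      · exact WGS1 i hi h
      · exact DW i h (mem_WG.1 hi).1
  · rw [Finset.mem_union]
    rintro (h | h)
    · exact h0S1 h
    · rw [hD, Finset.mem_filter, mem_CC] at h
      have := C.a_pos h.1.1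
      omega
  · intro h
    rcases Finset.mem_insert.1 h with h | h
    · omega
    · exact h0WG h
  · intro i hi j hj h
    rw [Finset.mem_union]
    rcases Finset.mem_insert.1 hi with rfl | hi
    swap
    · exact Or.inl (nbS1 i hi j hj h)
    by_cases e1 : j = i - 1 ∨ j = i + 1 ∨ j = i + 2
    · left; rw [mS1]; exact Or.inr e1
    have hne : j ≠ i := by rintro rfl; exact G.irrefl h
    by_cases e2 : i + 3 ≤ j
    · left
      rw [mS1]; left
      have hb := k3 j e2 hj h
      have ha : ¬ NA G p n (j - 1) := fun ha =>
        C.h3 i j (by omega) (by omega) hj h bq.2 ha.2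
      have := mem_PM_s (mem_WG.2 ⟨mem_WW.2 ⟨by omega, by omega, ha, hb⟩,
        (by omega : j - 1 ≠ i), by omega⟩)
      rwa [show j - 1 + 1 = j by omega] at this
    have hji : j + 2 ≤ i := by omega
    have ha : ¬ NA G p n (j + 1) := fun ha =>
      C.h1 j i hji (by omega) h.symm ha.2 bq.2
    by_cases e3 : w < j
    · left
      rw [mS1]; left
      have hb : ¬ NB G p n (j + 1) := fun hb =>
        C.k2 w i j hqn hadj aw.2 (by omega) hji h hb.2
      have := mem_PM_p (mem_WG.2 ⟨mem_WW.2 ⟨by omega, by omega, ha, hb⟩,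
        (by omega : j + 1 ≠ i), by omega⟩)
      rwa [show j + 1 - 1 = j by omega] at this
    · right
      have hj0 : j ≠ 0 := by
        rintro rfl
        exact hqW.2.2.1 ⟨by omega, h.symm⟩
      have hjw : j ≠ w := by
        rintro rfl
        exact ha aw
      have hb : ¬ NB G p n (j - 1) := fun hb =>
        C.k1 w i j hwq2 hqn hadj aw.2 (by omega) (by omega) h hb.2
      have l1 := (C.lab j (by omega) hne).resolve_left ha
      have l2 := (C.lab (j - 1) (by omega) (by omega)).resolve_right hb
      rw [show j - 1 + 1 = j by omega] at l2
      rw [hD, Finset.mem_filter]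
      exact ⟨mem_CC.2 ⟨l2, l1⟩, by omega⟩

theorem Base.flip (C : Base G p n) : Base G (fun i => p (n - 1 - i)) n := by
  have hn := C.hn
  refine ⟨hn, C.card, ?_, ?_, ?_, ?_, C.nham⟩
  · intro i j hi hj h
    have := C.inj _ _ (by omega) (by omega) h
    omega
  · intro v
    obtain ⟨i, hi, rfl⟩ := C.surj v
    exact ⟨n - 1 - i, by omega, by
      rw [show n - 1 - (n - 1 - i) = i by omega]⟩
  · intro i hi
    have := C.adj (n - 1 - (i + 1)) (by omega)
    rw [show n - 1 - (i + 1) + 1 = n - 1 - i by omega] at this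
    exact this.symm
  · simp only [Nat.sub_zero, Nat.sub_self]
    exact fun h => C.nadj h.symm

theorem flip_NA {i : ℕ} (h : i < n) : NA G (fun i => p (n - 1 - i)) n i ↔ NB G p n (n - 1 - i) := by
  simp only [NA, NB, Nat.sub_zero]
  constructor
  · exact fun g => ⟨by omega, g.2⟩
  · exact fun g => ⟨by omega, g.2⟩

theorem flip_NB {i : ℕ} (h : i < n) : NB G (fun i => p (n - 1 - i)) n i ↔ NA G p n (n - 1 - i) := by
  simp only [NA, NB, Nat.sub_self]
  constructor
  · exact fun g => ⟨by omega, g.2⟩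
  · exact fun g => ⟨by omega, g.2⟩

theorem flip_WW {i : ℕ} (h : n - 1 - i ∈ WW G p n) (hi : i < n) :
    i ∈ WW G (fun i => p (n - 1 - i)) n := by
  rw [mem_WW] at h ⊢
  rw [flip_NA hi, flip_NB hi]
  exact ⟨by omega, by omega, h.2.2.2, h.2.2.1⟩

theorem Cfg.flip (C : Cfg G p n q) (hq : q + 1 < n) :
    Cfg G (fun i => p (n - 1 - i)) n (n - 2 - q) := by
  refine { toBase := C.toBase.flip, lab := ?_, labq := ?_ }
  · intro i hi hne
    rw [flip_NA (by omega), flip_NB (by omega)]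
    have := C.lab (n - 1 - (i + 1)) (by omega) (by omega)
    rw [show n - 1 - (i + 1) + 1 = n - 1 - i by omega] at this
    exact this.symm
  · intro _
    rw [flip_NA (by omega), flip_NB (by omega)]
    rw [show n - 1 - (n - 2 - q + 1) = q by omega, show n - 1 - (n - 2 - q) = q + 1 by omega]
    exact (C.labq hq).symm

theorem Cfg.caseII' (C : Cfg G p n q) {t : ℝ} (ht : 9 / 4 < t) (hT : Tough t G)
    (hq : q ∈ WW G p n) (hq1 : q + 1 ∈ WW G p n) {w : ℕ} (hw : w ∈ WG G p n q) (hwq : q < w)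
    (hadj : G.Adj (p w) (p q)) : False := by
  have hqn := (mem_WW.1 hq1).2.1
  have hw' := mem_WG.1 hw
  have hwn := C.WG_lt w hw
  have hF := C.flip (by omega)
  refine hF.caseII ht hT (w := n - 1 - w) ?_ ?_ ?_ ?_ ?_
  · apply flip_WW _ (by omega)
    rwa [show n - 1 - (n - 2 - q) = q + 1 by omega]
  · apply flip_WW _ (by omega)
    rwa [show n - 1 - (n - 2 - q + 1) = q by omega]
  · refine mem_WG.2 ⟨flip_WW ?_ (by omega), by omega, by omega⟩
    rw [show n - 1 - (n - 1 - w) = w by omega]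
    exact hw'.1
  · omega
  · rwa [show n - 1 - (n - 1 - w) = w by omega, show n - 1 - (n - 2 - q + 1) = q by omega]

theorem Cfg.good_empty (C : Cfg G p n q) {t : ℝ} (ht : 9 / 4 < t) (hT : Tough t G) :
    WG G p n q = ∅ := by
  by_contra hne
  replace hne := Finset.nonempty_iff_ne_empty.2 hne
  by_cases hq : q ∈ WW G p n
  · have bq : NB G p n (q - 1) := C.wprev hq (by omega)
    have bq' := C.b_pos bq
    by_cases hq1 : q + 1 ∈ WW G p n
    · have aq : NA G p n (q + 2) := C.wnext hq1 (by omega)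
      refine C.caseR ht hT hne {q - 1, q + 2} Finset.card_le_two ?_ ?_ ?_
      · simp; omega
      · intro i hi h
        have := mem_WW.1 (mem_WG.1 h).1
        simp only [Finset.mem_insert, Finset.mem_singleton] at hi
        rcases hi with rfl | rfl
        · exact this.2.2.2 bq
        · exact this.2.2.1 aq
      · intro i hi j hj h
        simp only [Finset.mem_insert, Finset.mem_singleton]
        have hi' := mem_WG.1 hi
        rcases C.nb hi hj h with h1 | ⟨h1, ⟨rfl, h2⟩ | h2⟩ | ⟨h1, h2 | ⟨rfl, h2⟩⟩
        · exact Or.inl h1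
        · exact (C.caseII ht hT hq hq1 hi (by omega) h).elim
        · omega
        · omega
        · exact (C.caseII' ht hT hq hq1 hi (by omega) h).elim
    · refine C.caseR ht hT hne {q - 1, q + 1} Finset.card_le_two ?_ ?_ ?_
      · simp; omega
      · intro i hi h
        have hi' := mem_WG.1 h
        have := mem_WW.1 hi'.1
        simp only [Finset.mem_insert, Finset.mem_singleton] at hi
        rcases hi with rfl | rfl
        · exact this.2.2.2 bq
        · exact hi'.2.2 rfl
      · intro i hi j hj h
        simp only [Finset.mem_insert, Finset.mem_singleton]
        rcases C.nb hi hj h with h1 | ⟨h1, h2 | h2⟩ | ⟨h1, h2 | h2⟩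
        · exact Or.inl h1
        · omega
        · exact (hq1 h2.2).elim
        · omega
        · exact (hq1 h2.2).elim
  · by_cases hq1 : q + 1 ∈ WW G p n
    · have aq : NA G p n (q + 2) := C.wnext hq1 (by omega)
      refine C.caseR ht hT hne {q, q + 2} Finset.card_le_two ?_ ?_ ?_
      · simp only [Finset.mem_insert, Finset.mem_singleton]
        rintro (h | h)
        · have := (mem_WW.1 hq1)
          rw [← h] at this
          exact this.2.2.1 C.a_one
        · omega
      · intro i hi h
        have hi' := mem_WG.1 h
        have := mem_WW.1 hi'.1
        simp only [Finset.mem_insert, Finset.mem_singleton] at hi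
        rcases hi with rfl | rfl
        · exact hi'.2.1 rfl
        · exact this.2.2.1 aq
      · intro i hi j hj h
        simp only [Finset.mem_insert, Finset.mem_singleton]
        rcases C.nb hi hj h with h1 | ⟨h1, h2 | h2⟩ | ⟨h1, h2 | h2⟩
        · exact Or.inl h1
        · exact (hq h2.2).elim
        · omega
        · exact (hq h2.2).elim
        · omega
    · refine C.caseR ht hT hne ∅ (by simp) (by simp) (by simp) ?_
      intro i hi j hj h
      rcases C.nb hi hj h with h1 | ⟨h1, h2 | h2⟩ | ⟨h1, h2 | h2⟩
      · exact Or.inl h1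
      · exact (hq h2.2).elim
      · exact (hq1 h2.2).elim
      · exact (hq h2.2).elim
      · exact (hq1 h2.2).elim

end caseTwo

section final
variable {V : Type*} [Fintype V] [DecidableEq V] {G : SimpleGraph V} {p : ℕ → V} {n q : ℕ}

theorem Cfg.fin_aux (C : Cfg G p n q) {t : ℝ} (ht : 9 / 4 < t) (hT : Tough t G)
    (hW : WG G p n q = ∅) (E : Finset ℕ) (hE : E.card ≤ 2) (h0E : 0 ∉ E) (hnE : n - 1 ∉ E)
    (hqE : q ∈ E) (hqn : q ≠ n - 1)
    (H1 : q + 1 < n → q + 1 ∉ E → NA G p n (q + 2))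
    (H2 : q ∈ WW G p n → q - 1 ∉ E → NB G p n (q + 1)) : False := by
  classical
  have hn := C.hn
  have hWs : ∀ i ∈ WW G p n, i = q ∨ i = q + 1 := by
    intro i hi
    by_contra hcon
    have : i ∈ WG G p n q := mem_WG.2 ⟨hi, by tauto⟩
    rw [hW] at this
    simp at this
  have hCC : (CC G p n).card ≤ 2 := by
    have hc := C.cards
    by_cases h : q + 1 < n
    · have h1 := hc.2 h
      have h2 : WW G p n ⊆ {q, q + 1} := by
        intro i hi
        simpa using hWs i hi
      have h3 := Finset.card_le_card h2
      have h4 := Finset.card_le_two (a := q) (b := q + 1)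
      omega
    · have h1 : WW G p n = ∅ := by
        rw [Finset.eq_empty_iff_forall_notMem]
        intro i hi
        have h1 := hWs i hi
        have h2 := (mem_WW.1 hi).2.1
        omega
      rw [h1] at hc
      simp at hc
      omega
  have key : ∀ i j, i < j → j < n → i ∉ CC G p n ∪ E → j ∉ CC G p n ∪ E → G.Adj (p i) (p j) →
      (NA G p n (i + 1) ↔ NA G p n (j + 1)) := by
    intro i j hij hj hi hj' h
    simp only [Finset.mem_union, not_or] at hi hj'
    have hiq : i ≠ q := by rintro rfl; exact hi.2 hqE
    have hjq : j ≠ q := by rintro rfl; exact hj'.2 hqE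
    constructor
    · intro ha
      by_contra hb
      have hl : NA G p n j ∨ NB G p n (j - 1) := by
        by_cases e : j - 1 = q
        · have e' : j = q + 1 := by omega
          subst e'
          exact (hb (H1 hj hj'.2)).elim
        · have := C.lab (j - 1) (by omega) e
          rwa [show j - 1 + 1 = j by omega] at this
      rcases hl with hl | hl
      · have := C.a_pos hl
        have hB := (C.lab j (by omega) hjq).resolve_left hb
        exact hj'.1 (mem_CC.2 ⟨hl, hB⟩)
      · by_cases e : j = i + 1
        · subst e
          exact C.excl ha hl
        · exact C.h1 i j (by omega) hj h ha.2 hl.2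
    · intro ha
      by_contra hb
      have hj2 := C.a_pos ha
      have hB := (C.lab i (by omega) hiq).resolve_left hb
      have hi0 := C.b_pos hB
      have hB1 : ¬ NB G p n (i + 1) := fun hB1 => C.h4 i j hij (by omega) h hB1.2 ha.2
      have hw : i + 1 ∈ WW G p n := mem_WW.2 ⟨by omega, by omega, hb, hB1⟩
      have hq' : i + 1 = q := by
        have := hWs _ hw; omega
      subst hq'
      have hB2 := H2 hw (by simpa using hi.2)
      by_cases e : j = i + 1 + 1
      · subst e
        exact C.excl ha hB2
      · obtain ⟨c, h1, h2, h3⟩ := C.exW (s := i + 1 + 1) (e := j) (by omega) hB2 ha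
        have := hWs c h3
        omega
  have := C.tough_f ht hT (CC G p n ∪ E) (fun i => if NA G p n (i + 1) then 0 else 1) ?_
    {0, 1} ?_ (by simp)
  · have h1 := Finset.card_union_le (CC G p n) E
    simp at this
    omega
  · intro i j hi hj hiS hjS h
    have hne : i ≠ j := by rintro rfl; exact G.irrefl h
    have : NA G p n (i + 1) ↔ NA G p n (j + 1) := by
      rcases Nat.lt_or_gt_of_ne hne with h' | h'
      · exact key i j h' hj hiS hjS h
      · exact (key j i h' hi hjS hiS h.symm).symm
    simp only [this]
  · intro k hk
    simp only [Finset.mem_insert, Finset.mem_singleton] at hk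
    rcases hk with rfl | rfl
    · refine ⟨0, by omega, ?_, if_pos C.a_one⟩
      rw [Finset.mem_union, mem_CC]
      rintro (h | h)
      · exact absurd (C.a_pos h.1) (by omega)
      · exact h0E h
    · refine ⟨n - 1, by omega, ?_, if_neg ?_⟩
      · rw [Finset.mem_union, mem_CC]
        rintro (h | h)
        · exact absurd (C.a_pos h.1) (by omega)
        · exact hnE h
      · intro h
        exact absurd (C.a_pos h) (by omega)

theorem Cfg.contra (C : Cfg G p n q) {t : ℝ} (ht : 9 / 4 < t) (hT : Tough t G)
    (hqn : q ≠ n - 1) : False := by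
  have hn := C.hn
  have hW := C.good_empty ht hT
  have hq0 : q ≠ 0 := by
    rintro rfl
    exact (C.labq (by omega)).1 C.a_one
  have hq2 : q ≠ n - 2 := by
    rintro rfl
    exact (C.labq (by omega)).2 C.b_last
  by_cases hp : q ∈ WW G p n ∧ q + 1 ∈ WW G p n
  · have bq := C.b_pos (C.wprev hp.1 (by omega))
    refine C.fin_aux ht hT hW {q - 1, q} Finset.card_le_two ?_ ?_ (by simp) hqn ?_ ?_
    · simp; omega
    · simp; omega
    · intro _ _
      exact C.wnext hp.2 (by omega)
    · intro _ h
      simp at h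
  · refine C.fin_aux ht hT hW {q, q + 1} Finset.card_le_two ?_ ?_ (by simp) hqn ?_ ?_
    · simp; omega
    · simp; omega
    · intro _ h
      simp at h
    · intro hq _
      have hqW := mem_WW.1 hq
      have h1 : q + 1 ∉ WW G p n := fun h => hp ⟨hq, h⟩
      by_contra hb
      exact h1 (mem_WW.2 ⟨by omega, by omega, (C.labq hqW.2.1).1, hb⟩)

theorem Base.contra [DecidableRel G.Adj] (C : Base G p n) {t : ℝ} (ht : 9 / 4 < t)
    (hT : Tough t G) (hdeg : n - 2 ≤ G.degree (p 0) + G.degree (p (n - 1))) : False := by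
  classical
  have hn := C.hn
  have hdc : ∀ v, G.degree v ≤ ((Finset.range n).filter (fun i => G.Adj v (p i))).card := by
    intro v
    rw [← SimpleGraph.card_neighborFinset_eq_degree]
    have : G.neighborFinset v ⊆ ((Finset.range n).filter (fun i => G.Adj v (p i))).image p := by
      intro u hu
      rw [SimpleGraph.mem_neighborFinset] at hu
      obtain ⟨i, hi, rfl⟩ := C.surj u
      exact Finset.mem_image_of_mem _ (by simp [hi, hu])
    exact (Finset.card_le_card this).trans Finset.card_image_le
  set A := (Finset.range n).filter (fun i => G.Adj (p 0) (p i)) with hA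
  set B := (Finset.range n).filter (fun i => G.Adj (p (n - 1)) (p i)) with hB
  have mA : ∀ i, i ∈ A ↔ NA G p n i := by
    intro i; simp [hA, NA]
  have mB : ∀ i, i ∈ B ↔ NB G p n i := by
    intro i; simp [hB, NB]
  have e4 : (A.image (· - 1)).card = A.card := by
    apply Finset.card_image_of_injOn
    intro i hi j hj hij
    have h1 := C.a_pos ((mA i).1 hi)
    have h2 := C.a_pos ((mA j).1 hj)
    simp only at hij
    omega
  have mA' : ∀ i, i ∈ A.image (· - 1) ↔ NA G p n (i + 1) := by
    intro i
    rw [Finset.mem_image]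
    constructor
    · rintro ⟨j, hj, rfl⟩
      have := C.a_pos ((mA j).1 hj)
      rw [show j - 1 + 1 = j by omega]
      exact (mA j).1 hj
    · exact fun h => ⟨i + 1, (mA _).2 h, by omega⟩
  have e5 : (A.image (· - 1) ∪ B).card = A.card + B.card := by
    rw [Finset.card_union_of_disjoint, e4]
    rw [Finset.disjoint_left]
    intro i hi hi'
    exact C.excl ((mA' i).1 hi) ((mB i).1 hi')
  have e6 : A.image (· - 1) ∪ B ⊆ Finset.range (n - 1) := by
    intro i hi
    rw [Finset.mem_union] at hi
    rw [Finset.mem_range]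
    rcases hi with hi | hi
    · have := C.a_pos ((mA' i).1 hi); omega
    · have := C.b_pos ((mB i).1 hi); omega
  have e7 := Finset.card_sdiff_add_card_eq_card e6
  have h1 : _ ≤ A.card := hdc (p 0)
  have h2 : _ ≤ B.card := hdc (p (n - 1))
  rw [Finset.card_range] at e7
  have e8 : (Finset.range (n - 1) \ (A.image (· - 1) ∪ B)).card ≤ 1 := by omega
  have mM : ∀ i, i ∈ Finset.range (n - 1) \ (A.image (· - 1) ∪ B) ↔
      i + 1 < n ∧ ¬ (NA G p n (i + 1) ∨ NB G p n i) := by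
    intro i
    rw [Finset.mem_sdiff, Finset.mem_union, mA', mB, Finset.mem_range]
    refine and_congr_left fun _ => by omega
  rw [Finset.card_le_one] at e8
  by_cases hM : ∃ q, q + 1 < n ∧ ¬ (NA G p n (q + 1) ∨ NB G p n q)
  · obtain ⟨q, hq, hq'⟩ := hM
    refine Cfg.contra (q := q) { toBase := C, lab := ?_, labq := ?_ } ht hT (by omega)
    · intro i hi hne
      by_contra hcon
      exact hne (e8 i ((mM i).2 ⟨hi, hcon⟩) q ((mM q).2 ⟨hq, hq'⟩))
    · intro _
      exact not_or.1 hq'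
  · push Not at hM
    refine Cfg.contra (q := n) { toBase := C, lab := ?_, labq := ?_ } ht hT (by omega)
    · intro i hi _
      by_contra hcon
      rw [not_or] at hcon
      have := hM i hi
      tauto
    · intro h; omega

end final

theorem cycle_contra {V : Type*} [Fintype V] [DecidableEq V] {t : ℝ} (ht : 9 / 4 < t)
    (hn : 3 ≤ Fintype.card V) (G : SimpleGraph V) [DecidableRel G.Adj] (hT : Tough t G) (x y : V)
    (hnadj : ¬ G.Adj x y) (hdeg : Fintype.card V - 2 ≤ G.degree x + G.degree y)
    (hG : ¬ G.IsHamiltonian) (c : (G ⊔ fromEdgeSet {s(x, y)}).Walk x x)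
    (hc : c.IsHamiltonianCycle) (hy : c.getVert (Fintype.card V - 1) = y) : False := by
  set n := Fintype.card V with hnV
  have hlen : c.length = n := hc.length_eq
  have hcyc := hc.isCycle
  have hinj : ∀ i j, i < n → j < n → c.getVert i = c.getVert j → i = j := by
    intro i j hi hj h
    exact hcyc.getVert_injOn' (by rw [Set.mem_ofPred_eq]; omega)
      (by rw [Set.mem_ofPred_eq]; omega) h
  have h0 : c.getVert 0 = x := c.getVert_zero
  have hl : c.getVert n = x := by rw [← hlen]; exact c.getVert_length
  have C : Base G c.getVert n := by
    refine ⟨hn, rfl, hinj, ?_, ?_, ?_, hG⟩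
    · intro v
      have hv := hc.mem_support v
      rw [Walk.mem_support_iff_exists_getVert] at hv
      obtain ⟨i, hi, hi'⟩ := hv
      by_cases e : i = n
      · exact ⟨0, by omega, by rw [h0, ← hi, e, hl]⟩
      · exact ⟨i, by omega, hi⟩
    · intro i hi
      have h := c.adj_getVert_succ (i := i) (by omega)
      rw [sup_adj, fromEdgeSet_adj] at h
      rcases h with h | ⟨h, -⟩
      · exact h
      · exfalso
        rw [Set.mem_singleton_iff, Sym2.eq_iff] at h
        rcases h with ⟨h1, h2⟩ | ⟨h1, h2⟩
        · have := hinj i 0 (by omega) (by omega) (h1.trans h0.symm)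
          have := hinj (i + 1) (n - 1) (by omega) (by omega) (h2.trans hy.symm)
          omega
        · have := hinj (i + 1) 0 (by omega) (by omega) (h2.trans h0.symm)
          omega
    · rw [h0, hy]; exact hnadj
  refine C.contra ht hT ?_
  rw [h0, hy]; exact hdeg


/-- Let `ε > 1/4` be a real number, let `G` be a `(2+ε)`-tough graph on `n ≥ 3`
vertices, and let `x` and `y` be two non-adjacent vertices of `G` with
`d(x) + d(y) ≥ n - 2`. Then `G` is Hamiltonian if and only if the graph `G'` obtained
from `G` by adding the edge `xy` is Hamiltonian. -/
theorem stmt_4 {V : Type*} [Fintype V] [DecidableEq V]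
    (ε : ℝ) (hε : 1 / 4 < ε)
    (hn : 3 ≤ Fintype.card V)
    (G : SimpleGraph V) [DecidableRel G.Adj]
    (htough : Tough (2 + ε) G)
    (x y : V) (hxy : x ≠ y) (hnadj : ¬ G.Adj x y)
    (hdeg : Fintype.card V - 2 ≤ G.degree x + G.degree y) :
    G.IsHamiltonian ↔ (G ⊔ fromEdgeSet {s(x, y)}).IsHamiltonian := by
  constructor
  · exact fun h => h.mono le_sup_left
  intro h
  by_contra hG
  have : Nontrivial V := Fintype.one_lt_card_iff_nontrivial.1 (by omega)
  have ht : (9 : ℝ) / 4 < 2 + ε := by linarith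
  obtain ⟨c, hc⟩ := h.exists_isHamiltonianCycle x
  have hlen : c.length = Fintype.card V := hc.length_eq
  have hcyc := hc.isCycle
  have h0 : c.getVert 0 = x := c.getVert_zero
  by_cases hm : s(x, y) ∈ c.edges
  · rw [Walk.mk_mem_edges_iff_exists] at hm
    obtain ⟨i, hi, he⟩ := hm
    rw [Sym2.eq_iff] at he
    rcases he with ⟨h1, h2⟩ | ⟨h1, h2⟩
    · have hi0 : i = 0 := hcyc.getVert_injOn' (by rw [Set.mem_ofPred_eq]; omega)
        (by rw [Set.mem_ofPred_eq]; omega) (h1.trans h0.symm)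
      subst hi0
      refine cycle_contra ht hn G htough x y hnadj hdeg hG c.reverse ?_ ?_
      · rw [Walk.isHamiltonianCycle_iff_isCycle_and_length_eq]
        exact ⟨hcyc.reverse, by simpa using hlen⟩
      · rw [Walk.getVert_reverse, hlen,
          show Fintype.card V - (Fintype.card V - 1) = 0 + 1 by omega]
        exact h2
    · have hi0 : i + 1 = c.length := hcyc.getVert_injOn (by rw [Set.mem_ofPred_eq]; omega)
        (by rw [Set.mem_ofPred_eq]; omega) (h2.trans c.getVert_length.symm)
      refine cycle_contra ht hn G htough x y hnadj hdeg hG c hc ?_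
      rw [show Fintype.card V - 1 = i by omega]
      exact h1
  · apply hG
    intro _
    have hq : ∀ e ∈ c.edges, e ∈ G.edgeSet := by
      intro e he
      have h1 := c.edges_subset_edgeSet he
      rw [edgeSet_sup] at h1
      rcases h1 with h1 | h1
      · exact h1
      · rw [edgeSet_fromEdgeSet] at h1
        have h2 : e = s(x, y) := h1.1
        exact (hm (h2 ▸ he)).elim
    refine ⟨x, c.transfer G hq, ?_⟩
    rw [Walk.isHamiltonianCycle_iff_isCycle_and_length_eq]
    exact ⟨hcyc.transfer hq, by simpa using hlen⟩
end

section
/- Let t ≥ 2 be an integer, let G be a (3t−1)/2-tough graph on n ≥ 3 vertices, and let x and y be two non-adjacent vertices of G with d(x) + d(y) = n − t. Then G is Hamiltonian if and only if the graph obtained from G by adding the edge xy is Hamiltonian. -/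
open SimpleGraph

/-- `HP R a b s`: there is a path for `R` from `a` to `b` with vertex set `s`. -/
def HP (R : ℕ → ℕ → Prop) (a b : ℕ) (s : Finset ℕ) : Prop :=
  ∃ l : List ℕ, l.IsChain R ∧ l.Nodup ∧ l.toFinset = s ∧ l.head? = some a ∧ l.getLast? = some b

theorem HP.single (R : ℕ → ℕ → Prop) (a : ℕ) : HP R a a (Finset.Icc a a) :=
  ⟨[a], by simp, by simp, by simp, by simp, by simp⟩

theorem HP.rev {R : ℕ → ℕ → Prop} (hR : ∀ i j, R i j → R j i) {a b : ℕ} {s : Finset ℕ}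
    (h : HP R a b s) : HP R b a s := by
  obtain ⟨l, h1, h2, h3, h4, h5⟩ := h
  refine ⟨l.reverse, ?_, by simpa using h2, by simpa using h3, by simpa using h5, by simpa using h4⟩
  rw [List.isChain_reverse]
  exact h1.imp (fun a b h => hR _ _ h)

theorem HP.join {R : ℕ → ℕ → Prop} {a b c d : ℕ} {s s' : Finset ℕ}
    (h : HP R a b s) (hbc : R b c) (h' : HP R c d s') (hd : Disjoint s s') :
    HP R a d (s ∪ s') := by
  obtain ⟨l, h1, h2, h3, h4, h5⟩ := h
  obtain ⟨l', h1', h2', h3', h4', h5'⟩ := h'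
  refine ⟨l ++ l', ?_, ?_, ?_, ?_, ?_⟩
  · rw [List.isChain_append]
    refine ⟨h1, h1', ?_⟩
    intro x hx y hy
    rw [h5] at hx; rw [h4'] at hy
    simp at hx hy
    subst hx; subst hy; exact hbc
  · rw [List.nodup_append']
    refine ⟨h2, h2', ?_⟩
    rw [← List.disjoint_toFinset_iff_disjoint, h3, h3']; exact hd
  · simp [h3, h3']
  · simp [h4]
  · simp [h5']

theorem HP.seg {R : ℕ → ℕ → Prop} {N : ℕ} (hp : ∀ i, i < N → R i (i+1)) (a b : ℕ) (hab : a ≤ b)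
    (hb : b ≤ N) : HP R a b (Finset.Icc a b) := by
  induction b, hab using Nat.le_induction with
  | base => exact HP.single R a
  | succ b hab ih =>
    have := (ih (by omega)).join (hp b (by omega)) (HP.single R (b+1))
      (by rw [Finset.disjoint_left]; intro x; simp only [Finset.mem_Icc]; omega)
    convert this using 1
    ext x; simp only [Finset.mem_Icc, Finset.mem_union]; omega

section cycles

variable {R : ℕ → ℕ → Prop} {N : ℕ} (hR : ∀ i j, R i j → R j i) (hp : ∀ i, i < N → R i (i+1))
  (hno : ∀ a b, HP R a b (Finset.range (N+1)) → ¬ R b a)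

include hno in
theorem HP.fin {a b : ℕ} {s : Finset ℕ} (h : HP R a b s) (hba : R b a)
    (hs : s = Finset.range (N+1)) : False := hno a b (hs ▸ h) hba

include hR hp hno

theorem cyc_c0 {i : ℕ} (hi : i < N) (h1 : R N i) (h2 : R 0 (i+1)) : False := by
  refine HP.fin hno (((HP.seg hp 0 i (by omega) (by omega)).join (hR _ _ h1)
    ((HP.seg hp (i+1) N (by omega) (by omega)).rev hR) ?_)) (hR _ _ h2) ?_
  · rw [Finset.disjoint_left]; intro x; simp only [Finset.mem_Icc]; omega
  · ext x; simp only [Finset.mem_Icc, Finset.mem_union, Finset.mem_range]; omega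

theorem cyc_a1 {i j : ℕ} (hi : i + 2 ≤ N) (h1 : R N i) (h2 : R 0 (i+2)) (hj : j < i)
    (h3 : R (i+1) j) (h4 : R 0 (j+1)) : False := by
  refine HP.fin hno (((((HP.seg hp (j+1) i (by omega) (by omega)).join (hR _ _ h1)
    ((HP.seg hp (i+2) N (by omega) (by omega)).rev hR) ?_)).join (hR _ _ (hp (i+1) (by omega)))
    (HP.single R (i+1)) ?_).join h3 ((HP.seg hp 0 j (by omega) (by omega)).rev hR) ?_) h4 ?_
  iterate 3
    rw [Finset.disjoint_left]; intro x; simp only [Finset.mem_Icc, Finset.mem_union]; omega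
  · ext x; simp only [Finset.mem_Icc, Finset.mem_union, Finset.mem_range]; omega

theorem cyc_a2 {i j : ℕ} (hi : i + 2 ≤ N) (h2 : R 0 (i+2)) (hj : j < i)
    (h3 : R (i+1) j) (h4 : R N (j+1)) : False := by
  refine HP.fin hno (((HP.seg hp 0 j (by omega) (by omega)).join (hR _ _ h3)
    ((HP.seg hp (j+1) (i+1) (by omega) (by omega)).rev hR) ?_).join (hR _ _ h4)
    ((HP.seg hp (i+2) N (by omega) (by omega)).rev hR) ?_) (hR _ _ h2) ?_
  iterate 2
    rw [Finset.disjoint_left]; intro x; simp only [Finset.mem_Icc, Finset.mem_union]; omega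
  · ext x; simp only [Finset.mem_Icc, Finset.mem_union, Finset.mem_range]; omega

theorem cyc_a3 {i j : ℕ} (hi : i + 2 ≤ N) (h1 : R N i) (h2 : R 0 (i+2)) (hj : j < i)
    (h3 : R (i+1) j) (h4 : R (i+1) (j+1)) : False := by
  refine HP.fin hno ((((HP.seg hp 0 j (by omega) (by omega)).join (hR _ _ h3)
    (HP.single R (i+1)) ?_).join h4 (HP.seg hp (j+1) i (by omega) (by omega)) ?_).join (hR _ _ h1)
    ((HP.seg hp (i+2) N (by omega) (by omega)).rev hR) ?_) (hR _ _ h2) ?_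
  iterate 3
    rw [Finset.disjoint_left]; intro x; simp only [Finset.mem_Icc, Finset.mem_union]; omega
  · ext x; simp only [Finset.mem_Icc, Finset.mem_union, Finset.mem_range]; omega

theorem cyc_b1 {i j : ℕ} (hj : i + 2 ≤ j) (hN : j + 1 ≤ N) (h1 : R N i)
    (h3 : R (i+1) (j+1)) (h4 : R 0 j) : False := by
  refine HP.fin hno (((((HP.seg hp (j+1) N (by omega) (by omega)).rev hR).join (hR _ _ h3)
    (HP.seg hp (i+1) j (by omega) (by omega)) ?_).join (hR _ _ h4)
    (HP.seg hp 0 i (by omega) (by omega)) ?_)) (hR _ _ h1) ?_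
  iterate 2
    rw [Finset.disjoint_left]; intro x; simp only [Finset.mem_Icc, Finset.mem_union]; omega
  · ext x; simp only [Finset.mem_Icc, Finset.mem_union, Finset.mem_range]; omega

theorem cyc_b2 {i j : ℕ} (hj : i + 2 ≤ j) (hN : j + 1 ≤ N) (h2 : R 0 (i+2))
    (h3 : R (i+1) (j+1)) (h4 : R N j) : False := by
  refine HP.fin hno (((((HP.seg hp (i+2) j (by omega) (by omega)).rev hR).join (hR _ _ h2)
    (HP.seg hp 0 i (by omega) (by omega)) ?_).join (hp i (by omega)) (HP.single R (i+1)) ?_).join h3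
    (HP.seg hp (j+1) N (by omega) (by omega)) ?_) h4 ?_
  iterate 3
    rw [Finset.disjoint_left]; intro x; simp only [Finset.mem_Icc, Finset.mem_union]; omega
  · ext x; simp only [Finset.mem_Icc, Finset.mem_union, Finset.mem_range]; omega

theorem cyc_b3 {i j : ℕ} (hj : i + 2 ≤ j) (hN : j + 1 ≤ N) (h1 : R N i) (h2 : R 0 (i+2))
    (h3 : R (i+1) j) (h4 : R (i+1) (j+1)) : False := by
  refine HP.fin hno ((((HP.seg hp 0 i (by omega) (by omega)).join (hR _ _ h1)
    ((HP.seg hp (j+1) N (by omega) (by omega)).rev hR) ?_).join (hR _ _ h4)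
    (HP.single R (i+1)) ?_).join h3
    ((HP.seg hp (i+2) j (by omega) (by omega)).rev hR) ?_) (hR _ _ h2) ?_
  iterate 3
    rw [Finset.disjoint_left]; intro x; simp only [Finset.mem_Icc, Finset.mem_union]; omega
  · ext x; simp only [Finset.mem_Icc, Finset.mem_union, Finset.mem_range]; omega

theorem cyc_e1 {i j : ℕ} (hj : i + 1 ≤ j) (hN : j + 1 ≤ N) (h1 : R i (j+1)) (h2 : R 0 (i+1))
    (h3 : R N j) : False := by
  refine HP.fin hno (((HP.seg hp 0 i (by omega) (by omega)).join h1
    (HP.seg hp (j+1) N (by omega) (by omega)) ?_).join h3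
    ((HP.seg hp (i+1) j (by omega) (by omega)).rev hR) ?_) (hR _ _ h2) ?_
  iterate 2
    rw [Finset.disjoint_left]; intro x; simp only [Finset.mem_Icc, Finset.mem_union]; omega
  · ext x; simp only [Finset.mem_Icc, Finset.mem_union, Finset.mem_range]; omega

theorem cyc_e2 {i j : ℕ} (hj : i + 1 ≤ j) (hN : j + 1 ≤ N) (h1 : R i j) (h2 : R N (i+1))
    (h3 : R 0 (j+1)) : False := by
  refine HP.fin hno (((HP.seg hp 0 i (by omega) (by omega)).join h1
    ((HP.seg hp (i+1) j (by omega) (by omega)).rev hR) ?_).join (hR _ _ h2)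
    ((HP.seg hp (j+1) N (by omega) (by omega)).rev hR) ?_) (hR _ _ h3) ?_
  iterate 2
    rw [Finset.disjoint_left]; intro x; simp only [Finset.mem_Icc, Finset.mem_union]; omega
  · ext x; simp only [Finset.mem_Icc, Finset.mem_union, Finset.mem_range]; omega

end cycles

set_option maxHeartbeats 2000000 in
/-- combinatorial core -/
theorem ham_core (R : ℕ → ℕ → Prop) (N τ : ℕ) (hR : ∀ i j, R i j → R j i)
    (hirr : ∀ i, ¬ R i i)
    (hp : ∀ i, i < N → R i (i+1))
    (hno : ∀ a b, HP R a b (Finset.range (N+1)) → ¬ R b a) (hN : 1 ≤ N) (hτ : 1 ≤ τ)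
    (htough : ∀ (S : Finset ℕ) (g : ℕ → ℕ), S ⊆ Finset.range (N+1) →
      (∀ i j, i ≤ N → j ≤ N → i ∉ S → j ∉ S → R i j → g i = g j) →
      ∀ T : Finset ℕ, T ⊆ (Finset.range (N+1) \ S).image g → 2 ≤ T.card →
      (3 * τ + 2) * T.card ≤ 2 * S.card)
    (A B U : Finset ℕ) (hA : ∀ i, i ∈ A ↔ i < N ∧ R 0 (i+1))
    (hB : ∀ i, i ∈ B ↔ i < N ∧ R N i)
    (hU : ∀ i, i ∈ U ↔ i < N ∧ i ∉ A ∧ i ∉ B)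
    (hUc : U.card = τ) : False := by
  classical
  have hAB : ∀ i, i ∈ A → i ∈ B → False := by
    intro i h1 h2
    rw [hA] at h1; rw [hB] at h2
    exact cyc_c0 hR hp hno h1.1 h2.2 h1.2
  have h0N : ¬ R 0 N := by
    intro h
    exact hno 0 N (by
      convert HP.seg hp 0 N (by omega) le_rfl using 1
      ext x; simp only [Finset.mem_Icc, Finset.mem_range]; omega) (hR _ _ h)
  have h0A : 0 ∈ A := by rw [hA]; exact ⟨by omega, hp 0 (by omega)⟩
  have hNB : N - 1 ∈ B := by
    rw [hB]; refine ⟨by omega, hR _ _ ?_⟩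
    have := hp (N-1) (by omega)
    rwa [Nat.sub_add_cancel hN] at this
  set D := B.filter (fun i => i + 1 ∈ A) with hD
  have hDm : ∀ i, i ∈ D ↔ i ∈ B ∧ i + 1 ∈ A := by intro i; simp [hD]
  by_cases hDe : D = ∅
  · -- no direct transitions
    have hnoD : ∀ i, i ∈ B → i + 1 ∈ A → False := by
      intro i h1 h2
      have : i ∈ D := (hDm i).2 ⟨h1, h2⟩
      rw [hDe] at this; simp at this
    set B' := B.image (· + 1) with hB'
    have hB'm : ∀ i, i ∈ B' ↔ 1 ≤ i ∧ i - 1 ∈ B := by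
      intro i; simp only [hB', Finset.mem_image]
      constructor
      · rintro ⟨a, ha, rfl⟩; exact ⟨by omega, by simpa using ha⟩
      · rintro ⟨h1, h2⟩; exact ⟨i-1, h2, by omega⟩
    have hBc : B'.card = B.card := Finset.card_image_of_injective _ (fun a b h => by simpa using h)
    have hst : (B \ B').card ≤ τ + 1 := by
      rw [Finset.card_sdiff_comm hBc.symm, ← hUc]
      refine (Finset.card_le_card (t := insert N U) ?_).trans (Finset.card_insert_le _ _)
      intro q hq
      rw [Finset.mem_sdiff, hB'm] at hq
      obtain ⟨⟨h1, h2⟩, h3⟩ := hq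
      rw [Finset.mem_insert, hU]
      have h4 := ((hB _).1 h2).1
      by_cases hqN : q = N
      · exact Or.inl hqN
      · refine Or.inr ⟨by omega, fun h => hnoD _ h2 (by rwa [Nat.sub_add_cancel h1]), h3⟩
    set E := B.filter (fun i => i + 1 ∈ U) with hE
    have hEc : E.card ≤ τ := by
      rw [← hUc]
      refine Finset.card_le_card_of_injOn (· + 1) ?_ (fun a _ b _ h => by simpa using h)
      intro i hi
      have hi' : i ∈ E := hi
      rw [hE, Finset.mem_filter] at hi'
      exact hi'.2
    set S := U ∪ E ∪ (B \ B') with hS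
    have hSc : S.card ≤ 3 * τ + 1 := by
      have h1 := Finset.card_union_le (U ∪ E) (B \ B')
      have h2 := Finset.card_union_le U E
      rw [← hS] at h1
      omega
    have hSN : ∀ i ∈ S, i < N := by
      intro i hi
      simp only [hS, hE, Finset.mem_union, Finset.mem_sdiff, Finset.mem_filter] at hi
      rcases hi with (hi | hi) | hi
      · exact ((hU i).1 hi).1
      · exact ((hB i).1 hi.1).1
      · exact ((hB i).1 hi.1).1
    have hSA : ∀ i ∈ A, i ∉ S := by
      intro i hi hi'
      simp only [hS, hE, Finset.mem_union, Finset.mem_sdiff, Finset.mem_filter] at hi'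
      rcases hi' with (h | h) | h
      · exact ((hU i).1 h).2.1 hi
      · exact hAB _ hi h.1
      · exact hAB _ hi h.1
    -- key nonadjacency
    have key : ∀ i j, i ∈ A → j ≤ N → j ∉ S → j ∉ A → R i j → False := by
      intro i j hi hj hjS hjA hij
      have hi' := (hA i).1 hi
      simp only [hS, hE, Finset.mem_union, Finset.mem_sdiff, Finset.mem_filter, not_or, not_and,
        not_not] at hjS
      obtain ⟨⟨hjU, hjE⟩, hjB⟩ := hjS
      have hjcase : j = N ∨ j ∈ B := by
        by_contra hcon
        push Not at hcon
        exact hjU ((hU j).2 ⟨by omega, hjA, hcon.2⟩)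
      have hj1 : 1 ≤ j ∧ j - 1 ∈ B := by
        rcases hjcase with rfl | h
        · exact ⟨hN, hNB⟩
        · exact (hB'm j).1 (hjB h)
      have hne : i ≠ j := fun h => hirr i (h ▸ hij)
      rcases lt_or_gt_of_ne hne with hlt | hgt
      · have hne2 : i ≠ j - 1 := fun h => hAB i hi (h ▸ hj1.2)
        refine cyc_e1 hR hp hno (i := i) (j := j - 1) (by omega) (by omega) ?_ hi'.2
          ((hB _).1 hj1.2).2
        rwa [Nat.sub_add_cancel hj1.1]
      · have hjB' : j ∈ B := by
          rcases hjcase with h | h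
          · omega
          · exact h
        have h1 : j + 1 ∈ B := by
          by_contra hcon
          refine hjE hjB' ((hU _).2 ⟨by omega, fun h => hnoD j hjB' h, hcon⟩)
        exact cyc_e2 hR hp hno (i := j) (j := i) (by omega) (by omega) (hR _ _ hij)
          ((hB _).1 h1).2 hi'.2
    have := htough S (fun i => if i ∈ A then 1 else 0)
      (fun i hi => by have := hSN i hi; simp only [Finset.mem_range]; omega) ?_ {0, 1} ?_ (by simp)
    · have h2 : ({0, 1} : Finset ℕ).card = 2 := by simp
      rw [h2] at this
      omega
    · intro i j hi hj hiS hjS hij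
      by_cases h1 : i ∈ A <;> by_cases h2 : j ∈ A
      · simp [h1, h2]
      · exact (key i j h1 hj hjS h2 hij).elim
      · exact (key j i h2 hi hiS h1 (hR _ _ hij)).elim
      · simp [h1, h2]
    · intro q hq
      simp only [Finset.mem_insert, Finset.mem_singleton] at hq
      simp only [Finset.mem_image, Finset.mem_sdiff, Finset.mem_range]
      have hNA : N ∉ A := fun h => by have := ((hA _).1 h).1; omega
      rcases hq with rfl | rfl
      · exact ⟨N, ⟨by omega, fun h => by have := hSN N h; omega⟩, by simp [hNA]⟩
      · exact ⟨0, ⟨by omega, hSA 0 h0A⟩, by simp [h0A]⟩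
  · -- D nonempty
    set k := D.card with hk
    have hDdata : ∀ i ∈ D, i + 2 ≤ N ∧ R N i ∧ R 0 (i+2) ∧ i ∉ U ∧ i + 1 ∉ U := by
      intro i hi
      obtain ⟨h1, h2⟩ := (hDm i).1 hi
      have h3 := (hB _).1 h1
      have h4 := (hA _).1 h2
      refine ⟨by omega, h3.2, h4.2, fun h => ((hU _).1 h).2.2 h1, fun h => ((hU _).1 h).2.1 h2⟩
    have hleft : ∀ i ∈ D, ∀ j, j < i → R (i+1) j → j ∉ A ∧ j + 1 ∉ B := by
      intro i hi j hj hij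
      obtain ⟨h1, h2, h3, -, -⟩ := hDdata i hi
      refine ⟨fun h => cyc_a1 hR hp hno h1 h2 h3 hj hij ((hA _).1 h).2,
        fun h => cyc_a2 hR hp hno h1 h3 hj hij ((hB _).1 h).2⟩
    have hright : ∀ i ∈ D, ∀ j, i < j → j + 2 ≤ N → R (i+1) (j+2) → j ∉ A ∧ j + 1 ∉ B := by
      intro i hi j hj hjN hij
      obtain ⟨h1, h2, h3, -, -⟩ := hDdata i hi
      refine ⟨fun h => cyc_b1 hR hp hno (j := j+1) (by omega) (by omega) h2 hij ((hA _).1 h).2,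
        fun h => cyc_b2 hR hp hno (j := j+1) (by omega) (by omega) h3 hij ((hB _).1 h).2⟩
    have hcl : ∀ j, j + 1 < N → j ∉ A → j + 1 ∉ B → j ∈ D ∨ j ∈ U ∨ j + 1 ∈ U := by
      intro j hj h1 h2
      rw [hDm, hU, hU]
      by_cases h3 : j ∈ B <;> by_cases h4 : j + 1 ∈ A
      · exact Or.inl ⟨h3, h4⟩
      · exact Or.inr (Or.inr ⟨hj, h4, h2⟩)
      · exact Or.inr (Or.inl ⟨by omega, h1, h3⟩)
      · exact Or.inr (Or.inl ⟨by omega, h1, h3⟩)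
    -- neighbours
    set Nb : ℕ → Finset ℕ := fun i => (Finset.range (N+1)).filter (fun j => R (i+1) j) with hNb
    have hNbm : ∀ i j, j ∈ Nb i ↔ j ≤ N ∧ R (i+1) j := by
      intro i j; simp only [hNb, Finset.mem_filter, Finset.mem_range, Nat.lt_succ_iff]
    set Sp : ℕ → Finset ℕ := fun i => (Nb i).filter (fun j => (j < i ∧ (j ∈ U ∨ j + 1 ∈ U)) ∨
      (i + 2 < j ∧ (j - 2 ∈ U ∨ j - 1 ∈ U))) with hSp
    have hclass : ∀ i ∈ D, ∀ j ∈ Nb i, (j ∈ D ∧ j ≤ i) ∨ (2 ≤ j ∧ j - 2 ∈ D ∧ i ≤ j - 2) ∨ j ∈ Sp i := by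
      intro i hi j hj
      have hj' := (hNbm i j).1 hj
      obtain ⟨h1, h2, h3, h4, h5⟩ := hDdata i hi
      have hne : j ≠ i + 1 := fun h => hirr (i+1) (by have := hj'.2; rwa [h] at this)
      rcases lt_trichotomy j i with h | h | h
      · obtain ⟨h6, h7⟩ := hleft i hi j h hj'.2
        rcases hcl j (by omega) h6 h7 with h8 | h8
        · exact Or.inl ⟨h8, by omega⟩
        · right; right
          rw [hSp, Finset.mem_filter]
          exact ⟨hj, Or.inl ⟨h, h8⟩⟩
      · exact Or.inl ⟨h ▸ hi, by omega⟩
      · obtain ⟨m, rfl⟩ : ∃ m, j = m + 2 := ⟨j - 2, by omega⟩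
        by_cases hm : m = i
        · right; left
          subst hm
          exact ⟨by omega, by simpa using hi, by omega⟩
        · obtain ⟨h6, h7⟩ := hright i hi m (by omega) hj'.1 hj'.2
          rcases hcl m (by omega) h6 h7 with h8 | h8
          · right; left
            exact ⟨by omega, by simpa using h8, by omega⟩
          · right; right
            rw [hSp, Finset.mem_filter]
            exact ⟨hj, Or.inr ⟨by omega, by simpa using h8⟩⟩
    have hSpc : ∀ i ∈ D, (Sp i).card ≤ τ := by
      intro i hi
      rw [← hUc]
      obtain ⟨h1, h2, h3, h4, h5⟩ := hDdata i hi
      refine Finset.card_le_card_of_injOn (fun j => if j < i then (if j ∈ U then j else j + 1) else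
        (if j - 2 ∈ U then j - 2 else j - 1)) ?_ ?_
      · intro j hj
        have hj' : j ∈ Sp i := hj
        rw [hSp, Finset.mem_filter] at hj'
        show _ ∈ U
        rcases hj'.2 with ⟨h6, h7⟩ | ⟨h6, h7⟩
        · by_cases h8 : j ∈ U
          · simp [h6, h8]
          · simpa [h6, h8] using h7
        · have h9 : ¬ j < i := by omega
          by_cases h8 : j - 2 ∈ U
          · simp [h9, h8]
          · simpa [h9, h8] using h7
      · intro a ha b hb hab
        have ha' : a ∈ Sp i := ha
        have hb' : b ∈ Sp i := hb
        rw [hSp, Finset.mem_filter, hNbm] at ha' hb'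
        obtain ⟨⟨ha1, ha2⟩, ha3⟩ := ha'
        obtain ⟨⟨hb1, hb2⟩, hb3⟩ := hb'
        have hl : ∀ c, c < i → R (i+1) c → R (i+1) (c+1) → False :=
          fun c hc hc1 hc2 => cyc_a3 hR hp hno h1 h2 h3 hc hc1 hc2
        have hr : ∀ c, i + 2 ≤ c → c + 1 ≤ N → R (i+1) c → R (i+1) (c+1) → False :=
          fun c hc hc0 hc1 hc2 => cyc_b3 hR hp hno hc hc0 h2 h3 hc1 hc2
        have hl1 : a < i → b ≠ a + 1 := fun h h' => hl a h ha2 (h' ▸ hb2)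
        have hl2 : b < i → a ≠ b + 1 := fun h h' => hl b h hb2 (h' ▸ ha2)
        have hr1 : i + 2 ≤ a → b ≠ a + 1 := fun h h' => hr a h (by omega) ha2 (h' ▸ hb2)
        have hr2 : i + 2 ≤ b → a ≠ b + 1 := fun h h' => hr b h (by omega) hb2 (h' ▸ ha2)
        simp only at hab
        rcases ha3 with ⟨ha4, -⟩ | ⟨ha4, -⟩ <;> rcases hb3 with ⟨hb4, -⟩ | ⟨hb4, -⟩ <;>
          split_ifs at hab <;> omega
    have hNbc : ∀ i ∈ D, (Nb i).card ≤ k + 1 + τ := by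
      intro i hi
      have hsub : Nb i ⊆ (D.filter (· ≤ i)) ∪ ((D.filter (i ≤ ·)).image (· + 2)) ∪ Sp i := by
        intro j hj
        simp only [Finset.mem_union, Finset.mem_filter, Finset.mem_image]
        rcases hclass i hi j hj with h | ⟨h, h', h''⟩ | h
        · exact Or.inl (Or.inl h)
        · exact Or.inl (Or.inr ⟨j - 2, ⟨h', h''⟩, by omega⟩)
        · exact Or.inr h
      have h1 := Finset.card_le_card hsub
      have h2 := Finset.card_union_le ((D.filter (· ≤ i)) ∪ ((D.filter (i ≤ ·)).image (· + 2))) (Sp i)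
      have h3 := Finset.card_union_le (D.filter (· ≤ i)) ((D.filter (i ≤ ·)).image (· + 2))
      have h4 : ((D.filter (i ≤ ·)).image (· + 2)).card ≤ (D.filter (i ≤ ·)).card :=
        Finset.card_image_le
      have h5 := hSpc i hi
      have h6 : (D.filter (· ≤ i)).card + (D.filter (i ≤ ·)).card ≤ k + 1 := by
        rw [← Finset.card_union_add_card_inter]
        refine Nat.add_le_add (Finset.card_le_card ?_) ?_
        · intro q; simp only [Finset.mem_union, Finset.mem_filter]; tauto
        · rw [Finset.card_le_one]
          intro a ha b hb
          simp only [Finset.mem_inter, Finset.mem_filter] at ha hb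
          omega
      omega
    have hNb0 : ∀ i ∈ D, 0 ∉ Nb i := by
      intro i hi h
      have h1 := (hNbm i 0).1 h
      have h2 := (hDm i).1 hi
      exact hAB i ((hA i).2 ⟨((hB _).1 h2.1).1, hR _ _ h1.2⟩) h2.1
    have hk2 : 2 * τ + 1 ≤ k := by
      obtain ⟨i, hi⟩ := Finset.nonempty_iff_ne_empty.2 hDe
      have h1 := hNbc i hi
      have h2 := hDdata i hi
      have := htough (Nb i) (fun j => if j = i + 1 then 1 else 0) (Finset.filter_subset _ _) ?_
        {0, 1} ?_ (by simp)
      · have h2 : ({0, 1} : Finset ℕ).card = 2 := by simp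
        rw [h2] at this
        omega
      · intro a b ha hb ha' hb' hab
        have h3 : a ≠ i + 1 := fun h => hb' ((hNbm _ _).2 ⟨hb, h ▸ hab⟩)
        have h4 : b ≠ i + 1 := fun h => ha' ((hNbm _ _).2 ⟨ha, hR _ _ (h ▸ hab)⟩)
        simp [h3, h4]
      · intro q hq
        simp only [Finset.mem_insert, Finset.mem_singleton] at hq
        simp only [Finset.mem_image, Finset.mem_sdiff, Finset.mem_range]
        rcases hq with rfl | rfl
        · exact ⟨0, ⟨by omega, hNb0 i hi⟩, by simp⟩
        · exact ⟨i+1, ⟨by omega, fun h => hirr _ ((hNbm _ _).1 h).2⟩, by simp⟩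
    set S := D.biUnion Nb with hS
    have hDS : ∀ j ∈ D, j + 1 ∉ S := by
      intro j hj h
      rw [hS, Finset.mem_biUnion] at h
      obtain ⟨i, hi, hij⟩ := h
      have hij' := ((hNbm _ _).1 hij)
      have hi1 := (hDm _).1 hi
      have hj1 := (hDm _).1 hj
      have hj2 := hDdata j hj
      rcases lt_trichotomy (j+1) i with h | h | h
      · exact (hleft i hi (j+1) h hij'.2).1 hj1.2
      · exact hAB i (h ▸ hj1.2) hi1.1
      · by_cases h2 : j = i
        · exact hirr _ (h2 ▸ hij'.2)
        · by_cases h3 : j = i + 1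
          · exact hAB j (h3 ▸ hi1.2) hj1.1
          · obtain ⟨m, rfl⟩ : ∃ m, j = m + 1 := ⟨j - 1, by omega⟩
            exact (hright i hi m (by omega) (by omega) hij'.2).2 hj1.1
    have hmain : (3 * τ + 2) * (k + 1) ≤ 2 * S.card := by
      have hT : (insert 0 (D.image (· + 1))).card = k + 1 := by
        rw [Finset.card_insert_of_notMem (by simp),
          Finset.card_image_of_injective _ (fun a b h => by simpa using h)]
      have := htough S (fun j => if j ∈ D.image (· + 1) then j else 0) ?_ ?_
        (insert 0 (D.image (· + 1))) ?_ (by omega)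
      · rwa [hT] at this
      · intro j hj
        rw [hS, Finset.mem_biUnion] at hj
        obtain ⟨i, hi, hij⟩ := hj
        exact Finset.filter_subset _ _ hij
      · have aux : ∀ a b, b ≤ N → b ∉ S → R a b → a ∉ D.image (· + 1) := by
          intro a b hb hbS hab h
          rw [Finset.mem_image] at h
          obtain ⟨i, hi, rfl⟩ := h
          exact hbS (Finset.mem_biUnion.2 ⟨i, hi, (hNbm _ _).2 ⟨hb, hab⟩⟩)
        intro a b ha hb ha' hb' hab
        rw [if_neg (aux a b hb hb' hab), if_neg (aux b a ha ha' (hR _ _ hab))]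
      · intro q hq
        rw [Finset.mem_insert] at hq
        rw [Finset.mem_image]
        rcases hq with rfl | hq
        · refine ⟨0, ?_, by simp⟩
          simp only [Finset.mem_sdiff, Finset.mem_range]
          refine ⟨by omega, fun h => ?_⟩
          rw [hS, Finset.mem_biUnion] at h
          obtain ⟨i, hi, hij⟩ := h
          exact hNb0 i hi hij
        · refine ⟨q, ?_, by simp only [if_pos hq]⟩
          rw [Finset.mem_image] at hq
          obtain ⟨i, hi, rfl⟩ := hq
          have := hDdata i hi
          simp only [Finset.mem_sdiff, Finset.mem_range]
          exact ⟨by omega, hDS i hi⟩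
    have hS1 : S.card ≤ 2 * k + k * τ := by
      have hsub : S ⊆ D ∪ D.image (· + 2) ∪ D.biUnion Sp := by
        intro j hj
        rw [hS, Finset.mem_biUnion] at hj
        obtain ⟨i, hi, hij⟩ := hj
        simp only [Finset.mem_union, Finset.mem_image, Finset.mem_biUnion]
        rcases hclass i hi j hij with h | ⟨h, h', h''⟩ | h
        · exact Or.inl (Or.inl h.1)
        · exact Or.inl (Or.inr ⟨j - 2, h', by omega⟩)
        · exact Or.inr ⟨i, hi, h⟩
      have h1 := Finset.card_le_card hsub
      have h2 := Finset.card_union_le (D ∪ D.image (· + 2)) (D.biUnion Sp)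
      have h3 := Finset.card_union_le D (D.image (· + 2))
      have h4 : (D.image (· + 2)).card ≤ k := Finset.card_image_le
      have h5 := Finset.card_biUnion_le_card_mul D Sp τ hSpc
      rw [← hk] at h5
      omega
    have hS2 : S.card ≤ 2 * k + 4 * τ := by
      have hsub : S ⊆ (D ∪ D.image (· + 2)) ∪ ((U ∪ U.image (· - 1)) ∪ (U.image (· + 1) ∪ U.image (· + 2))) := by
        intro j hj
        rw [hS, Finset.mem_biUnion] at hj
        obtain ⟨i, hi, hij⟩ := hj
        simp only [Finset.mem_union, Finset.mem_image]
        rcases hclass i hi j hij with h | ⟨h, h', h''⟩ | h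
        · exact Or.inl (Or.inl h.1)
        · exact Or.inl (Or.inr ⟨j - 2, h', by omega⟩)
        · right
          rw [hSp, Finset.mem_filter] at h
          rcases h.2 with ⟨h1, h2 | h2⟩ | ⟨h1, h2 | h2⟩
          · exact Or.inl (Or.inl h2)
          · exact Or.inl (Or.inr ⟨_, h2, by omega⟩)
          · exact Or.inr (Or.inr ⟨_, h2, by omega⟩)
          · exact Or.inr (Or.inl ⟨_, h2, by omega⟩)
      have h1 := Finset.card_le_card hsub
      have h2 := Finset.card_union_le (D ∪ D.image (· + 2)) ((U ∪ U.image (· - 1)) ∪ (U.image (· + 1) ∪ U.image (· + 2)))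
      have h3 := Finset.card_union_le D (D.image (· + 2))
      have h4 : (D.image (· + 2)).card ≤ k := Finset.card_image_le
      have h5 := Finset.card_union_le (U ∪ U.image (· - 1)) (U.image (· + 1) ∪ U.image (· + 2))
      have h6 := Finset.card_union_le U (U.image (· - 1))
      have h7 := Finset.card_union_le (U.image (· + 1)) (U.image (· + 2))
      have h8 : (U.image (· - 1)).card ≤ U.card := Finset.card_image_le
      have h9 : (U.image (· + 1)).card ≤ U.card := Finset.card_image_le
      have h10 : (U.image (· + 2)).card ≤ U.card := Finset.card_image_le
      omega
    rcases Nat.lt_or_ge τ 2 with h | h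
    · have : τ = 1 := by omega
      subst this
      omega
    · nlinarith

theorem ham_of_list {V : Type*} [Fintype V] [DecidableEq V] (G : SimpleGraph V)
    (hn : 3 ≤ Fintype.card V) (l : List V) (hc : l.IsChain G.Adj) (hnd : l.Nodup)
    (hl : l.length = Fintype.card V) (a b : V) (ha : l.head? = some a) (hb : l.getLast? = some b)
    (hba : G.Adj b a) : G.IsHamiltonian := by
  intro _
  have hne : l ≠ [] := by rintro rfl; simp at ha
  have ha' : l.head hne = a := by
    rw [List.head?_eq_some_head hne] at ha; simpa using ha
  have hb' : l.getLast hne = b := by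
    rw [List.getLast?_eq_some_getLast hne] at hb; simpa using hb
  have hadj : G.Adj (l.getLast hne) (l.head hne) := by rw [ha', hb']; exact hba
  set w := Walk.ofSupport l hne hc with hw
  have hs : w.support = l := Walk.support_ofSupport hne hc
  have hlen : w.length = l.length - 1 := Walk.length_ofSupport hne hc
  have hpath : w.IsPath := Walk.IsPath.mk' (by rw [hs]; exact hnd)
  refine ⟨_, Walk.cons hadj w, ?_⟩
  rw [Walk.isHamiltonianCycle_iff_isCycle_and_length_eq]
  refine ⟨?_, ?_⟩
  · rw [Walk.cons_isCycle_iff]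
    refine ⟨hpath, fun h => ?_⟩
    have := hpath.length_eq_one_of_mem_edges (Sym2.eq_swap ▸ h)
    omega
  · rw [Walk.length_cons]; omega

theorem tough_index {V : Type*} [Fintype V] [DecidableEq V] (G : SimpleGraph V) (τ : ℕ)
    (htough : Tough ((3 * ((τ + 1 : ℕ) : ℝ) - 1) / 2) G) (S : Finset V) (f : V → ℕ)
    (hf : ∀ a b, a ∉ S → b ∉ S → G.Adj a b → f a = f b) (T : Finset ℕ)
    (hT : ∀ q ∈ T, ∃ a, a ∉ S ∧ f a = q) (hT2 : 2 ≤ T.card) :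
    (3 * τ + 2) * T.card ≤ 2 * S.card := by
  classical
  set H := G.induce ((↑S : Set V)ᶜ) with hH
  have hwalk : ∀ (a b : ((↑S : Set V)ᶜ : Set V)) (p : H.Walk a b), f a = f b := by
    intro a b p
    induction p with
    | nil => rfl
    | @cons a b c h p ih =>
      rw [← ih]
      exact hf _ _ (fun q => (Set.mem_compl_iff _ _).1 a.2 (Finset.mem_coe.2 q))
        (fun q => (Set.mem_compl_iff _ _).1 b.2 (Finset.mem_coe.2 q)) (by simpa [hH] using h)
  let φ : H.ConnectedComponent → ℕ := ConnectedComponent.lift (fun a => f a) (fun a b p _ => hwalk a b p)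
  have hcard : T.card ≤ Nat.card H.ConnectedComponent := by
    rw [Nat.card_eq_fintype_card]
    refine (Finset.card_le_card (t := Finset.univ.image φ) ?_).trans (Finset.card_image_le)
    intro q hq
    obtain ⟨a, ha, haq⟩ := hT q hq
    rw [Finset.mem_image]
    exact ⟨H.connectedComponentMk ⟨a, by simpa using ha⟩, Finset.mem_univ _, haq⟩
  have hnc : ¬ H.Connected := by
    intro h
    have := h.preconnected.subsingleton_connectedComponent
    have h1 : Nat.card H.ConnectedComponent ≤ 1 := Finite.card_le_one_iff_subsingleton.2 this
    omega
  have h1 := htough S hnc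
  have h2 : (T.card : ℝ) ≤ (Nat.card H.ConnectedComponent : ℝ) := by exact_mod_cast hcard
  have h3 : ((3 * τ + 2 : ℕ) : ℝ) * T.card ≤ 2 * S.card := by
    push_cast at h1 ⊢
    have h4 : (0 : ℝ) ≤ 3 * τ + 2 := by positivity
    have h5 := mul_le_mul_of_nonneg_left h2 h4
    have h6 : (3 * ((τ : ℝ) + 1) - 1) / 2 = (3 * τ + 2) / 2 := by ring
    rw [h6] at h1
    linarith
  exact_mod_cast h3

theorem ham_of_path {V : Type*} [Fintype V] [DecidableEq V]
    (τ N : ℕ) (hτ : 1 ≤ τ) (hn : 3 ≤ Fintype.card V) (hNc : Fintype.card V = N + 1)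
    (G : SimpleGraph V) [DecidableRel G.Adj]
    (htough : Tough ((3 * ((τ + 1 : ℕ) : ℝ) - 1) / 2) G)
    (v : ℕ → V) (hinj : ∀ i j, i ≤ N → j ≤ N → v i = v j → i = j)
    (hp : ∀ i, i < N → G.Adj (v i) (v (i+1)))
    (hdeg : G.degree (v 0) + G.degree (v N) = Fintype.card V - (τ + 1)) : G.IsHamiltonian := by
  classical
  by_contra hH
  have himg : (Finset.range (N+1)).image v = Finset.univ := by
    apply Finset.eq_univ_of_card
    rw [Finset.card_image_of_injOn, Finset.card_range, hNc]
    intro i hi j hj h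
    simp only [Finset.coe_range, Set.mem_Iio] at hi hj
    exact hinj i j (by omega) (by omega) h
  have hsurj : ∀ a, ∃ i, i ≤ N ∧ v i = a := by
    intro a
    have : a ∈ (Finset.range (N+1)).image v := himg ▸ Finset.mem_univ a
    obtain ⟨i, hi, h⟩ := Finset.mem_image.1 this
    exact ⟨i, by simp at hi; omega, h⟩
  choose w hw1 hw2 using hsurj
  have hwv : ∀ i, i ≤ N → w (v i) = i := fun i hi => hinj _ _ (hw1 _) hi (hw2 _)
  set R : ℕ → ℕ → Prop := fun i j => G.Adj (v i) (v j) with hRdef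
  have hR : ∀ i j, R i j → R j i := fun i j h => SimpleGraph.Adj.symm h
  have hno : ∀ a b, HP R a b (Finset.range (N+1)) → ¬ R b a := by
    rintro a b ⟨l, h1, h2, h3, h4, h5⟩ hba
    apply hH
    refine ham_of_list G hn (l.map v) ?_ ?_ ?_ (v a) (v b) (by simp [h4]) (by simp [h5]) hba
    · rw [List.isChain_map]; exact h1
    · refine List.Nodup.map_on ?_ h2
      intro i hi j hj h
      rw [← List.mem_toFinset, h3, Finset.mem_range] at hi hj
      exact hinj i j (by omega) (by omega) h
    · rw [List.length_map, ← List.toFinset_card_of_nodup h2, h3, Finset.card_range, hNc]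
  set A := (Finset.range N).filter (fun i => R 0 (i+1)) with hA
  set B := (Finset.range N).filter (fun i => R N i) with hB
  set U := Finset.range N \ (A ∪ B) with hU
  have hAm : ∀ i, i ∈ A ↔ i < N ∧ R 0 (i+1) := by intro i; simp [hA]
  have hBm : ∀ i, i ∈ B ↔ i < N ∧ R N i := by intro i; simp [hB]
  have hUm : ∀ i, i ∈ U ↔ i < N ∧ i ∉ A ∧ i ∉ B := by
    intro i; rw [hU, Finset.mem_sdiff, Finset.mem_union, Finset.mem_range, not_or]
  have hAc : A.card = G.degree (v 0) := by
    rw [← SimpleGraph.card_neighborFinset_eq_degree]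
    refine Finset.card_bij (fun i _ => v (i+1)) ?_ ?_ ?_
    · intro i hi; rw [SimpleGraph.mem_neighborFinset]; exact ((hAm i).1 hi).2
    · intro i hi j hj h
      have h1 := ((hAm i).1 hi).1
      have h2 := ((hAm j).1 hj).1
      have := hinj _ _ (by omega) (by omega) h
      omega
    · intro a ha
      rw [SimpleGraph.mem_neighborFinset] at ha
      have h0 : w a ≠ 0 := by
        intro h
        have := hw2 a
        rw [h] at this
        exact G.ne_of_adj ha this
      have h1 := hw1 a
      have h2 : w a - 1 + 1 = w a := by omega
      exact ⟨w a - 1, (hAm _).2 ⟨by omega, by rw [h2, hRdef]; simpa [hw2] using ha⟩,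
        by rw [h2, hw2]⟩
  have hBc : B.card = G.degree (v N) := by
    rw [← SimpleGraph.card_neighborFinset_eq_degree]
    refine Finset.card_bij (fun i _ => v i) ?_ ?_ ?_
    · intro i hi; rw [SimpleGraph.mem_neighborFinset]; exact ((hBm i).1 hi).2
    · intro i hi j hj h
      have h1 := ((hBm i).1 hi).1
      have h2 := ((hBm j).1 hj).1
      exact hinj _ _ (by omega) (by omega) h
    · intro a ha
      rw [SimpleGraph.mem_neighborFinset] at ha
      have h0 : w a ≠ N := by
        intro h
        have := hw2 a
        rw [h] at this
        exact G.ne_of_adj ha this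
      have h1 := hw1 a
      exact ⟨w a, (hBm _).2 ⟨by omega, by rw [hRdef]; simpa [hw2] using ha⟩, hw2 a⟩
  have hdisj : Disjoint A B := by
    rw [Finset.disjoint_left]
    intro i h1 h2
    exact cyc_c0 hR hp hno ((hAm i).1 h1).1 ((hBm i).1 h2).2 ((hAm i).1 h1).2
  have hA1 : 1 ≤ A.card := Finset.card_pos.2 ⟨0, (hAm 0).2 ⟨by omega, hp 0 (by omega)⟩⟩
  have hUc : U.card = τ := by
    have h1 : A ∪ B ⊆ Finset.range N :=
      Finset.union_subset (Finset.filter_subset _ _) (Finset.filter_subset _ _)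
    rw [hU, Finset.card_sdiff_of_subset h1, Finset.card_union_of_disjoint hdisj, Finset.card_range]
    have h2 := Finset.card_le_card h1
    rw [Finset.card_union_of_disjoint hdisj, Finset.card_range] at h2
    omega
  refine ham_core R N τ hR (fun i => G.loopless.irrefl _) hp hno (by omega) hτ ?_ A B U hAm hBm hUm hUc
  intro S g hS hg T hT hT2
  refine (tough_index G τ htough (S.image v) (fun a => g (w a)) ?_ T ?_ hT2).trans
    (Nat.mul_le_mul_left _ Finset.card_image_le)
  · intro a b ha hb hab
    refine hg _ _ (hw1 _) (hw1 _) (fun h => ha ?_) (fun h => hb ?_) ?_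
    · exact Finset.mem_image.2 ⟨_, h, hw2 a⟩
    · exact Finset.mem_image.2 ⟨_, h, hw2 b⟩
    · simpa [hRdef, hw2] using hab
  · intro q hq
    obtain ⟨i, hi, hiq⟩ := Finset.mem_image.1 (hT hq)
    rw [Finset.mem_sdiff, Finset.mem_range] at hi
    refine ⟨v i, fun h => ?_, by simpa only [hwv i (by omega)] using hiq⟩
    obtain ⟨j, hj, hji⟩ := Finset.mem_image.1 h
    have hj' := hS hj
    rw [Finset.mem_range] at hj'
    have := hinj j i (by omega) (by omega) hji
    exact hi.2 (this ▸ hj)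

/-- Let `t ≥ 2` be an integer, let `G` be a `(3t-1)/2`-tough graph on `n ≥ 3` vertices,
and let `x` and `y` be two non-adjacent vertices of `G` with `d(x) + d(y) = n - t`.
Then `G` is Hamiltonian if and only if the graph obtained from `G` by adding the edge
`xy` is Hamiltonian. -/
theorem stmt_5 {V : Type*} [Fintype V] [DecidableEq V]
    (t : ℕ) (ht : 2 ≤ t)
    (hn : 3 ≤ Fintype.card V)
    (G : SimpleGraph V) [DecidableRel G.Adj]
    (htough : Tough ((3 * t - 1 : ℝ) / 2) G)
    (x y : V) (hxy : x ≠ y) (hnadj : ¬ G.Adj x y)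
    (hdeg : G.degree x + G.degree y = Fintype.card V - t) :
    G.IsHamiltonian ↔ (G ⊔ fromEdgeSet {s(x, y)}).IsHamiltonian := by
  refine ⟨fun h => h.mono le_sup_left, fun h => ?_⟩
  obtain ⟨τ, rfl⟩ : ∃ τ, t = τ + 1 := ⟨t - 1, by omega⟩
  obtain ⟨N, hN⟩ : ∃ N, Fintype.card V = N + 1 := ⟨Fintype.card V - 1, by omega⟩
  obtain ⟨a, p, hpc⟩ := h (by omega)
  have hlen : p.length = N + 1 := by rw [hpc.length_eq, hN]
  set c : ℕ → V := fun k => p.getVert (k % (N+1)) with hc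
  have hcinj : ∀ i j, c i = c j → i % (N+1) = j % (N+1) := by
    intro i j hij
    have h1 := Nat.mod_lt i (show 0 < N + 1 by omega)
    have h2 := Nat.mod_lt j (show 0 < N + 1 by omega)
    exact hpc.isCycle.getVert_injOn' (by simp only [Set.mem_ofPred_eq]; omega)
      (by simp only [Set.mem_ofPred_eq]; omega) hij
  have hcadj : ∀ i, (G ⊔ fromEdgeSet {s(x, y)}).Adj (c i) (c (i+1)) := by
    intro i
    have h1 := Nat.mod_lt i (show 0 < N + 1 by omega)
    have h2 := p.adj_getVert_succ (i := i % (N+1)) (by omega)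
    have h3 : c (i+1) = p.getVert (i % (N+1) + 1) := by
      simp only [hc]
      rw [Nat.add_mod, Nat.mod_eq_of_lt (show 1 < N + 1 by omega)]
      by_cases h4 : i % (N+1) + 1 = N + 1
      · rw [h4, Nat.mod_self, ← hlen, p.getVert_length, p.getVert_zero]
      · rw [Nat.mod_eq_of_lt (by omega)]
    rw [h3]; exact h2
  have hcadj' : ∀ i, G.Adj (c i) (c (i+1)) ∨ (c i = x ∧ c (i+1) = y) ∨ (c i = y ∧ c (i+1) = x) := by
    intro i
    have := hcadj i
    rw [SimpleGraph.sup_adj, SimpleGraph.fromEdgeSet_adj] at this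
    rcases this with h | h
    · exact Or.inl h
    · right; simpa using h.1
  have hshift : ∀ k i j, i ≤ N → j ≤ N → c (k + i) = c (k + j) → i = j := by
    intro k i j hi hj hij
    have h1 := hcinj _ _ hij
    have h2 : i ≡ j [MOD (N+1)] := Nat.ModEq.add_left_cancel' k h1
    exact Nat.ModEq.eq_of_lt_of_lt h2 (by omega) (by omega)
  have hwrap : ∀ k, c (k + 1 + N) = c k := by
    intro k
    simp only [hc]
    rw [show k + 1 + N = k + (N + 1) by omega, Nat.add_mod_right]
  by_cases hall : ∀ k, G.Adj (c k) (c (k+1))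
  · refine ham_of_list G hn ((List.range (N+1)).map c) ?_ ?_ (by simp [hN]) (c 0) (c N) ?_ ?_ ?_
    · rw [List.isChain_map]
      exact (List.isChain_range_succ _ _).2 (fun m _ => hall m)
    · refine List.Nodup.map_on ?_ List.nodup_range
      intro i hi j hj h
      rw [List.mem_range] at hi hj
      exact hshift 0 i j (by omega) (by omega) (by simpa using h)
    · simp [List.head?_range]
    · simp [List.getLast?_range]
    · have := hall N
      have h2 := hwrap 0
      have h3 : c (N+1) = c 0 := by simp [hc]
      rwa [h3] at this
  · push Not at hall
    obtain ⟨k, hk⟩ := hall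
    have hk' := (hcadj' k).resolve_left hk
    refine ham_of_path τ N (by omega) hn hN G htough (fun j => c (k + 1 + j)) (hshift (k+1)) ?_ ?_
    · intro i hi
      rcases hcadj' (k + 1 + i) with h | h
      · exact h
      · exfalso
        have e0 : c (k + 1) = c (k + 1 + 0) := rfl
        have eN := hwrap k
        rw [e0, ← eN] at hk'
        have key : ∀ i j, i ≤ N → j ≤ N → c (k + 1 + i) = c (k+1+j) → i = j := hshift (k+1)
        have hh : (i = N ∧ i + 1 = 0) ∨ (i = 0 ∧ i + 1 = N) := by
          rcases hk' with ⟨q1, q2⟩ | ⟨q1, q2⟩ <;> rcases h with ⟨q3, q4⟩ | ⟨q3, q4⟩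
          · exact Or.inl ⟨key _ _ (by omega) (by omega) (q3.trans q1.symm),
              key _ _ (by omega) (by omega) (q4.trans q2.symm)⟩
          · exact Or.inr ⟨key _ _ (by omega) (by omega) (q3.trans q2.symm),
              key _ _ (by omega) (by omega) (q4.trans q1.symm)⟩
          · exact Or.inr ⟨key _ _ (by omega) (by omega) (q3.trans q2.symm),
              key _ _ (by omega) (by omega) (q4.trans q1.symm)⟩
          · exact Or.inl ⟨key _ _ (by omega) (by omega) (q3.trans q1.symm),
              key _ _ (by omega) (by omega) (q4.trans q2.symm)⟩
        omega
    · simp only [Nat.add_zero]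
      rw [hwrap k]
      rcases hk' with ⟨q1, q2⟩ | ⟨q1, q2⟩
      · rw [q1, q2, Nat.add_comm]; exact hdeg
      · rw [q1, q2]; exact hdeg
end
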